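/- arXiv:1705.01361 — 3 statements merged into one kernel-verified Lean document; each statement's English description precedes it below -/
import Mathlib

section
/- For every k ≥ 3 and positive integers n_1, …, n_k, the right-angled Coxeter group W_{Θ(n_1,…,n_k)} admits a properly discontinuous action by homeomorphisms on some contractible topological 3-manifold (without boundary). -/
open scoped Classical

/-- Vertices of the generalized Θ-graph `Θ(n 0, …, n (k-1))`: two essential vertices
(`Sum.inl true` and `Sum.inl false`) together with `n i` interior vertices on the `i`-th
path. -/
abbrev ThetaVertex {k : ℕ} (n : Fin k → ℕ) : Type :=
  Bool ⊕ (Σ i : Fin k, Fin (n i))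

/-- Adjacency in the generalized Θ-graph: the essential vertex `true` is adjacent to the
first interior vertex of each path, the essential vertex `false` to the last, and
consecutive interior vertices of a common path are adjacent. -/
def ThetaAdj {k : ℕ} (n : Fin k → ℕ) : ThetaVertex n → ThetaVertex n → Prop
  | Sum.inl _, Sum.inl _ => False
  | Sum.inl e, Sum.inr ⟨i, j⟩ => (e = true ∧ (j : ℕ) = 0) ∨ (e = false ∧ (j : ℕ) = n i - 1)
  | Sum.inr ⟨i, j⟩, Sum.inl e => (e = true ∧ (j : ℕ) = 0) ∨ (e = false ∧ (j : ℕ) = n i - 1)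
  | Sum.inr ⟨i, j⟩, Sum.inr ⟨i', j'⟩ =>
      (i : ℕ) = (i' : ℕ) ∧ ((j' : ℕ) = (j : ℕ) + 1 ∨ (j : ℕ) = (j' : ℕ) + 1)

/-- The right-angled Coxeter relators of a graph: `v²` for each vertex `v` and `(uv)²` for
each pair of adjacent vertices. -/
def racgRelators {V : Type} (adj : V → V → Prop) : Set (FreeGroup V) :=
  {w | (∃ v, w = FreeGroup.of v ^ 2) ∨
    ∃ u v, adj u v ∧ w = (FreeGroup.of u * FreeGroup.of v) ^ 2}

/-- The right-angled Coxeter group of a graph given by its adjacency relation. -/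
abbrev RACG {V : Type} (adj : V → V → Prop) : Type :=
  PresentedGroup (racgRelators adj)

/-- The right-angled Coxeter group `W_{Θ(n 0, …, n (k-1))}` with nerve the generalized
Θ-graph. -/
abbrev ThetaRACG {k : ℕ} (n : Fin k → ℕ) : Type :=
  RACG (ThetaAdj n)

/-- The linear degree of `Θ(n 0, …, n (k-1))`: the number of paths with one interior
vertex. -/
noncomputable def linearDegree {k : ℕ} (n : Fin k → ℕ) : ℕ :=
  (Finset.univ.filter fun i => n i = 1).card
/-- A topological 3-manifold without boundary: a nonempty, Hausdorff, second-countable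
space in which every point has an open neighborhood homeomorphic to an open subset of
`ℝ³`. -/
def IsTopological3Manifold (M : Type) [TopologicalSpace M] : Prop :=
  Nonempty M ∧ T2Space M ∧ SecondCountableTopology M ∧
    ∀ x : M, ∃ (U : Set M) (V : Set (ℝ × ℝ × ℝ)),
      x ∈ U ∧ IsOpen U ∧ IsOpen V ∧ Nonempty (U ≃ₜ V)

section ReflectionRepresentation

variable {S : Type} (adj : S → S → Prop)

/-- The Cartan matrix of the right-angled Coxeter group: `2` on the diagonal, `0` at adjacent
pairs and `-2` at the remaining pairs. -/
noncomputable def racgCartan (s t : S) : ℝ :=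
  if s = t then 2 else if adj s t then 0 else -2

/-- The linear reflection of `S → ℝ` attached to the generator `s`. -/
noncomputable def racgReflection (s : S) : (S → ℝ) →ₗ[ℝ] (S → ℝ) where
  toFun y t := y t - y s * racgCartan adj s t
  map_add' x y := by ext t; simp; ring
  map_smul' a y := by ext t; simp; ring

theorem racgReflection_apply (s t : S) (y : S → ℝ) :
    racgReflection adj s y t = y t - y s * racgCartan adj s t := rfl

theorem racgCartan_self (s : S) : racgCartan adj s s = 2 := by simp [racgCartan]

theorem racgReflection_involutive (s : S) : Function.Involutive (racgReflection adj s) := by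
  intro y
  ext t
  simp only [racgReflection_apply, racgCartan_self]
  ring

/-- The reflection as a linear automorphism. -/
noncomputable def racgReflectionEquiv (s : S) : (S → ℝ) ≃ₗ[ℝ] (S → ℝ) :=
  LinearEquiv.ofInvolutive (racgReflection adj s) (racgReflection_involutive adj s)

theorem racgReflectionEquiv_apply (s t : S) (y : S → ℝ) :
    racgReflectionEquiv adj s y t = y t - y s * racgCartan adj s t := rfl

variable {adj}

theorem racgCartan_of_adj (hirr : ∀ s, ¬ adj s s) {s t : S} (h : adj s t) :
    racgCartan adj s t = 0 := by
  have : s ≠ t := fun e => hirr t (e ▸ h)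
  simp [racgCartan, this, h]

theorem racgCartan_of_not_adj {s t : S} (hne : s ≠ t) (h : ¬ adj s t) :
    racgCartan adj s t = -2 := by
  simp [racgCartan, hne, h]

theorem racgReflectionEquiv_relators (hirr : ∀ s, ¬ adj s s) (hsymm : ∀ s t, adj s t → adj t s) :
    ∀ r ∈ racgRelators adj, FreeGroup.lift (racgReflectionEquiv adj) r = 1 := by
  rintro r (⟨v, rfl⟩ | ⟨u, v, h, rfl⟩)
  · ext1 y
    rw [pow_two, map_mul, FreeGroup.lift_apply_of]
    exact racgReflection_involutive adj v y
  · ext y t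
    have h1 := racgCartan_of_adj hirr h
    have h2 := racgCartan_of_adj hirr (hsymm _ _ h)
    simp only [pow_two, map_mul, FreeGroup.lift_apply_of, LinearEquiv.mul_apply,
      racgReflectionEquiv_apply, racgCartan_self, h1, h2, LinearEquiv.coe_one, id]
    ring

/-- The reflection representation of a right-angled Coxeter group. -/
noncomputable def racgRep (hirr : ∀ s, ¬ adj s s) (hsymm : ∀ s t, adj s t → adj t s) :
    RACG adj →* ((S → ℝ) ≃ₗ[ℝ] (S → ℝ)) :=
  PresentedGroup.toGroup (racgReflectionEquiv_relators hirr hsymm)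

/-- The standard generators of a right-angled Coxeter group. -/
def racgGen (adj : S → S → Prop) (s : S) : RACG adj := PresentedGroup.of s

theorem racgRep_gen (hirr : ∀ s, ¬ adj s s) (hsymm : ∀ s t, adj s t → adj t s) (s t : S)
    (y : S → ℝ) :
    racgRep hirr hsymm (racgGen adj s) y t = y t - y s * racgCartan adj s t := by
  rw [racgRep, racgGen, PresentedGroup.toGroup.of, racgReflectionEquiv_apply]

theorem racgGen_mul_self (s : S) : racgGen adj s * racgGen adj s = 1 := by
  have h : (PresentedGroup.mk (racgRelators adj)) (FreeGroup.of s ^ 2) = 1 :=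
    PresentedGroup.one_of_mem (Or.inl ⟨s, rfl⟩)
  rwa [map_pow, pow_two] at h

theorem racgGen_inv (s : S) : (racgGen adj s)⁻¹ = racgGen adj s :=
  inv_eq_of_mul_eq_one_left (racgGen_mul_self s)

theorem racgGen_mul_cancel (s : S) (w : RACG adj) :
    racgGen adj s * (racgGen adj s * w) = w := by
  rw [← mul_assoc, racgGen_mul_self, one_mul]

theorem racgGen_comm {s t : S} (h : adj s t) :
    racgGen adj s * racgGen adj t = racgGen adj t * racgGen adj s := by
  have h : (PresentedGroup.mk (racgRelators adj)) ((FreeGroup.of s * FreeGroup.of t) ^ 2) = 1 :=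
    PresentedGroup.one_of_mem (Or.inr ⟨s, t, h, rfl⟩)
  rw [map_pow, pow_two, map_mul] at h
  have := eq_inv_of_mul_eq_one_left h
  rw [mul_inv_rev] at this
  change racgGen adj s * racgGen adj t = (racgGen adj t)⁻¹ * (racgGen adj s)⁻¹ at this
  rwa [racgGen_inv, racgGen_inv] at this

end ReflectionRepresentation

section WordLength

variable {S : Type} {adj : S → S → Prop}

theorem racg_exists_word (w : RACG adj) : ∃ l : List S, (l.map (racgGen adj)).prod = w := by
  have hw : w ∈ Subgroup.closure (Set.range (racgGen adj)) := by
    have := PresentedGroup.closure_range_of (racgRelators adj)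
    change Subgroup.closure (Set.range (racgGen adj)) = ⊤ at this
    rw [this]; trivial
  induction hw using Subgroup.closure_induction_left with
  | one => exact ⟨[], rfl⟩
  | mul_left x hx y _ ih =>
    obtain ⟨s, rfl⟩ := hx
    obtain ⟨l, rfl⟩ := ih
    exact ⟨s :: l, by simp⟩
  | inv_mul_cancel x hx y _ ih =>
    obtain ⟨s, rfl⟩ := hx
    obtain ⟨l, rfl⟩ := ih
    exact ⟨s :: l, by simp [racgGen_inv]⟩

/-- The word length of an element of a right-angled Coxeter group. -/
noncomputable def racgLength (w : RACG adj) : ℕ :=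
  sInf {m | ∃ l : List S, l.length = m ∧ (l.map (racgGen adj)).prod = w}

theorem racgLength_prod_le (l : List S) : racgLength (l.map (racgGen adj)).prod ≤ l.length :=
  Nat.sInf_le ⟨l, rfl, rfl⟩

theorem racg_exists_reduced_word (w : RACG adj) :
    ∃ l : List S, l.length = racgLength w ∧ (l.map (racgGen adj)).prod = w := by
  obtain ⟨l, hl⟩ := racg_exists_word w
  exact Nat.sInf_mem (s := {m | ∃ l : List S, l.length = m ∧ (l.map (racgGen adj)).prod = w})
    ⟨_, l, rfl, hl⟩

theorem racgLength_gen_mul_le (s : S) (w : RACG adj) :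
    racgLength (racgGen adj s * w) ≤ racgLength w + 1 := by
  obtain ⟨l, hl, rfl⟩ := racg_exists_reduced_word w
  rw [← hl]
  simpa using racgLength_prod_le (adj := adj) (s :: l)

theorem racg_exists_descent {w : RACG adj} (hw : w ≠ 1) :
    ∃ s, racgLength (racgGen adj s * w) < racgLength w := by
  obtain ⟨l, hl, rfl⟩ := racg_exists_reduced_word w
  cases l with
  | nil => exact absurd rfl hw
  | cons s l =>
    refine ⟨s, ?_⟩
    rw [← hl, List.map_cons, List.prod_cons, racgGen_mul_cancel]
    exact Nat.lt_succ_of_le (racgLength_prod_le l)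

/-- The sign character, sending every generator to `-1`. -/
noncomputable def racgSign (adj : S → S → Prop) : RACG adj →* ℤˣ :=
  PresentedGroup.toGroup (f := fun _ => -1) (by
    rintro r (⟨v, rfl⟩ | ⟨u, v, -, rfl⟩) <;> simp)

theorem racgSign_eq (w : RACG adj) : racgSign adj w = (-1) ^ racgLength w := by
  obtain ⟨l, hl, hw⟩ := racg_exists_reduced_word w
  rw [← hl, ← hw]
  clear hl hw
  induction l with
  | nil => simp
  | cons s l ih =>
    rw [List.map_cons, List.prod_cons, map_mul, ih, List.length_cons, pow_succ', racgSign, racgGen,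
      PresentedGroup.toGroup.of]

theorem racgLength_gen_mul_ne (s : S) (w : RACG adj) :
    racgLength (racgGen adj s * w) ≠ racgLength w := by
  intro h
  have h1 := racgSign_eq (racgGen adj s * w)
  rw [h, ← racgSign_eq, map_mul, racgSign, racgGen, PresentedGroup.toGroup.of] at h1
  simp at h1

end WordLength

section TitsCone

variable {S : Type} {adj : S → S → Prop}

/-- The finite-type part of the fundamental chamber: nonnegative vectors whose zero set is a
clique. -/
def racgChamber (adj : S → S → Prop) : Set (S → ℝ) :=
  {c | (∀ s, 0 ≤ c s) ∧ ∀ s t, s ≠ t → c s = 0 → c t = 0 → adj s t}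

variable (hirr : ∀ s, ¬ adj s s) (hsymm : ∀ s t, adj s t → adj t s)

theorem racgRep_gen_mul (s t : S) (w : RACG adj) (y : S → ℝ) :
    racgRep hirr hsymm (racgGen adj s * w) y t =
      racgRep hirr hsymm w y t - racgRep hirr hsymm w y s * racgCartan adj s t := by
  rw [map_mul, LinearEquiv.mul_apply, racgRep_gen]

theorem racgRep_gen_fix {s : S} {y : S → ℝ} (h : y s = 0) :
    racgRep hirr hsymm (racgGen adj s) y = y := by
  ext t
  rw [racgRep_gen, h]; ring

/-- The position of a chamber with respect to the walls of the fundamental chamber, together with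
the strict positivity of the sum of two non-commuting coordinates on the Tits cone. -/
theorem racgRep_chamber_pos {c : S → ℝ} (hc : c ∈ racgChamber adj) (w : RACG adj) :
    (∀ s, racgLength w < racgLength (racgGen adj s * w) → 0 ≤ racgRep hirr hsymm w c s) ∧
    ∀ s t, s ≠ t → ¬ adj s t → 0 < racgRep hirr hsymm w c s + racgRep hirr hsymm w c t := by
  induction hm : racgLength w using Nat.strong_induction_on generalizing w with
  | _ m ih =>
  subst hm
  by_cases hw : w = 1
  · subst hw
    refine ⟨fun s _ => by simpa using hc.1 s, fun s t hst hadj => ?_⟩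
    simp only [map_one, LinearEquiv.coe_one, id]
    have hs := hc.1 s
    have ht := hc.1 t
    by_contra hcon
    exact hadj (hc.2 s t hst (by linarith) (by linarith))
  have key : ∀ r, racgLength (racgGen adj r * w) < racgLength w → ∀ s,
      racgLength w < racgLength (racgGen adj s * w) →
      0 ≤ racgRep hirr hsymm w c s ∧ (racgRep hirr hsymm (racgGen adj r * w) c s < 0 →
        0 < racgRep hirr hsymm w c s) ∧
      (0 ≤ racgRep hirr hsymm (racgGen adj r * w) c s →
        racgRep hirr hsymm (racgGen adj r * w) c s ≤ racgRep hirr hsymm w c s) := by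
    intro r hr s hs
    have hrs : r ≠ s := by rintro rfl; omega
    obtain ⟨v, rfl⟩ : ∃ v, w = racgGen adj r * v := ⟨racgGen adj r * w, (racgGen_mul_cancel r w).symm⟩
    rw [racgGen_mul_cancel] at hr ⊢
    obtain ⟨ihP, ihJ⟩ := ih _ hr v rfl
    have hr0 := ihP r hr
    rw [racgRep_gen_mul]
    by_cases hadj : adj r s
    · rw [racgCartan_of_adj hirr hadj]
      have h0 : 0 ≤ racgRep hirr hsymm v c s := by
        apply ihP
        by_contra hcon
        have h1 := racgLength_gen_mul_le r (racgGen adj s * v)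
        rw [← mul_assoc, racgGen_comm hadj, mul_assoc] at h1
        have h2 := racgLength_gen_mul_ne s v
        omega
      refine ⟨by linarith, fun h => by linarith, fun h => by linarith⟩
    · rw [racgCartan_of_not_adj hrs hadj]
      have h0 := ihJ r s hrs hadj
      refine ⟨by linarith, fun h => by linarith, fun h => by linarith⟩
  obtain ⟨r, hr⟩ := racg_exists_descent hw
  refine ⟨fun s hs => (key r hr s hs).1, fun s t hst hadj => ?_⟩
  have descent : ∀ s t, s ≠ t → ¬ adj s t → racgLength (racgGen adj s * w) < racgLength w →
      0 < racgRep hirr hsymm w c s + racgRep hirr hsymm w c t := by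
    intro s t hst hadj hs
    have h0 := (ih _ hs _ rfl).2 s t hst hadj
    rw [racgRep_gen_mul, racgRep_gen_mul, racgCartan_self, racgCartan_of_not_adj hst hadj] at h0
    linarith
  rcases lt_or_gt_of_ne (racgLength_gen_mul_ne s w) with hs | hs
  · exact descent s t hst hadj hs
  rcases lt_or_gt_of_ne (racgLength_gen_mul_ne t w) with ht | ht
  · rw [add_comm]
    exact descent t s hst.symm (fun h => hadj (hsymm _ _ h)) ht
  obtain ⟨s0, s1, s2⟩ := key r hr s hs
  obtain ⟨t0, t1, t2⟩ := key r hr t ht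
  have h0 := (ih _ hr _ rfl).2 s t hst hadj
  rcases lt_or_ge (racgRep hirr hsymm (racgGen adj r * w) c s) 0 with h | h
  · linarith [s1 h]
  rcases lt_or_ge (racgRep hirr hsymm (racgGen adj r * w) c t) 0 with h' | h'
  · linarith [t1 h']
  linarith [s2 h, t2 h']

theorem racgRep_nonpos_of_descent {c : S → ℝ} (hc : c ∈ racgChamber adj) {w : RACG adj} {s : S}
    (hs : racgLength (racgGen adj s * w) < racgLength w) : racgRep hirr hsymm w c s ≤ 0 := by
  have h := (racgRep_chamber_pos hirr hsymm hc (racgGen adj s * w)).1 s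
    (by rwa [racgGen_mul_cancel])
  rw [racgRep_gen_mul, racgCartan_self] at h
  linarith

/-- The chamber is a strict fundamental domain. -/
theorem racgRep_chamber_eq {c c' : S → ℝ} (hc : c ∈ racgChamber adj)
    (hc' : c' ∈ racgChamber adj) (w : RACG adj) (h : racgRep hirr hsymm w c = c') :
    c = c' ∧ w ∈ Subgroup.closure (racgGen adj '' {s | c' s = 0}) := by
  induction hm : racgLength w using Nat.strong_induction_on generalizing w with
  | _ m ih =>
  subst hm
  by_cases hw : w = 1
  · subst hw
    exact ⟨by simpa using h, one_mem _⟩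
  obtain ⟨s, hs⟩ := racg_exists_descent hw
  have h1 := racgRep_nonpos_of_descent hirr hsymm hc hs
  rw [h] at h1
  have h0 : c' s = 0 := le_antisymm h1 (hc'.1 s)
  obtain ⟨h2, h3⟩ := ih _ hs (racgGen adj s * w)
    (by rw [map_mul, LinearEquiv.mul_apply, h, racgRep_gen_fix hirr hsymm h0]) rfl
  refine ⟨h2, ?_⟩
  have h4 := mul_mem (Subgroup.subset_closure (Set.mem_image_of_mem (racgGen adj)
    (show s ∈ {s | c' s = 0} from h0))) h3
  rwa [racgGen_mul_cancel] at h4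

theorem racgRep_fix_of_mem_closure {Z : Set S} {w : RACG adj}
    (hw : w ∈ Subgroup.closure (racgGen adj '' Z)) {d : S → ℝ} (hd : ∀ s ∈ Z, d s = 0) :
    racgRep hirr hsymm w d = d := by
  induction hw using Subgroup.closure_induction with
  | mem x hx =>
    obtain ⟨s, hs, rfl⟩ := hx
    exact racgRep_gen_fix hirr hsymm (hd s hs)
  | one => simp
  | mul x y _ _ hx hy => rw [map_mul, LinearEquiv.mul_apply, hy, hx]
  | inv x _ hx =>
    rw [map_inv]
    exact (LinearEquiv.symm_apply_eq _).2 hx.symm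

/-- The elements of the parabolic subgroups generated by at most two generators, provided these
commute. -/
def racgShort (adj : S → S → Prop) : Set (RACG adj) :=
  ⋃ e : S × S, {1, racgGen adj e.1, racgGen adj e.2, racgGen adj e.1 * racgGen adj e.2}

theorem racgShort_finite [Finite S] : (racgShort adj).Finite :=
  Set.finite_iUnion fun _ => by simp

theorem mem_racgShort_of_mem_closure {s t : S} (hst : adj s t) {Z : Set S} (hZ : Z ⊆ {s, t})
    {w : RACG adj} (hw : w ∈ Subgroup.closure (racgGen adj '' Z)) : w ∈ racgShort adj := by
  refine Set.mem_iUnion.2 ⟨(s, t), ?_⟩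
  have hcomm := racgGen_comm hst
  have step : ∀ r ∈ Z, ∀ y ∈ ({1, racgGen adj s, racgGen adj t, racgGen adj s * racgGen adj t} :
      Set (RACG adj)), racgGen adj r * y ∈ ({1, racgGen adj s, racgGen adj t,
        racgGen adj s * racgGen adj t} : Set (RACG adj)) := by
    rintro r hr y (rfl | rfl | rfl | rfl) <;> rcases hZ hr with rfl | rfl <;>
      simp [racgGen_mul_self, racgGen_mul_cancel, ← hcomm]
    rw [← mul_assoc, ← hcomm, mul_assoc, racgGen_mul_self]
    simp
  induction hw using Subgroup.closure_induction_left with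
  | one => simp
  | mul_left x hx y _ ih =>
    obtain ⟨r, hr, rfl⟩ := hx
    exact step r hr y ih
  | inv_mul_cancel x hx y _ ih =>
    obtain ⟨r, hr, rfl⟩ := hx
    rw [racgGen_inv]
    exact step r hr y ih

/-- The union of the translates of the chamber: the interior of the Tits cone. -/
def racgTitsCone : Set (S → ℝ) :=
  {y | ∃ w : RACG adj, racgRep hirr hsymm w y ∈ racgChamber adj}

theorem racgRep_mul_apply (v w : RACG adj) (y : S → ℝ) :
    racgRep hirr hsymm (v * w) y = racgRep hirr hsymm v (racgRep hirr hsymm w y) := by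
  rw [map_mul, LinearEquiv.mul_apply]

theorem racgRep_inv_apply_self (w : RACG adj) (y : S → ℝ) :
    racgRep hirr hsymm w⁻¹ (racgRep hirr hsymm w y) = y := by
  rw [← racgRep_mul_apply, inv_mul_cancel, map_one, LinearEquiv.coe_one, id]

theorem racgRep_apply_inv_self (w : RACG adj) (y : S → ℝ) :
    racgRep hirr hsymm w (racgRep hirr hsymm w⁻¹ y) = y := by
  rw [← racgRep_mul_apply, mul_inv_cancel, map_one, LinearEquiv.coe_one, id]

theorem racgRep_mem_titsCone (w : RACG adj) {y : S → ℝ} (hy : y ∈ racgTitsCone hirr hsymm) :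
    racgRep hirr hsymm w y ∈ racgTitsCone hirr hsymm := by
  obtain ⟨v, hv⟩ := hy
  exact ⟨v * w⁻¹, by rwa [racgRep_mul_apply, racgRep_inv_apply_self]⟩

theorem racgChamber_subset_titsCone : racgChamber adj ⊆ racgTitsCone hirr hsymm :=
  fun c hc => ⟨1, by simpa using hc⟩

theorem racgTitsCone_pair_pos {y : S → ℝ} (hy : y ∈ racgTitsCone hirr hsymm) {s t : S}
    (hst : s ≠ t) (hadj : ¬ adj s t) : 0 < y s + y t := by
  obtain ⟨w, hw⟩ := hy
  have := (racgRep_chamber_pos hirr hsymm hw w⁻¹).2 s t hst hadj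
  rwa [racgRep_inv_apply_self] at this

/-- A segment from a point of the chamber to a point `y` of the Tits cone stays in the cone. -/
theorem racg_segment_subset_titsCone [Finite S] (w : RACG adj) {x y : S → ℝ}
    (hx : x ∈ racgChamber adj) (hy : racgRep hirr hsymm w⁻¹ y ∈ racgChamber adj) :
    segment ℝ x y ⊆ racgTitsCone hirr hsymm := by
  induction hm : racgLength w using Nat.strong_induction_on generalizing w x y with
  | _ m ih =>
  subst hm
  have hxT := racgChamber_subset_titsCone hirr hsymm hx
  have hyT : y ∈ racgTitsCone hirr hsymm := ⟨_, hy⟩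
  have hpair : ∀ z ∈ segment ℝ x y, (∀ s, 0 ≤ z s) → z ∈ racgChamber adj := by
    rintro z ⟨a, b, ha, hb, hab, rfl⟩ hz
    refine ⟨hz, fun s t hst hs ht => ?_⟩
    by_contra hadj
    have h1 := racgTitsCone_pair_pos hirr hsymm hxT hst hadj
    have h2 := racgTitsCone_pair_pos hirr hsymm hyT hst hadj
    simp only [Pi.add_apply, Pi.smul_apply, smul_eq_mul] at hs ht
    have h3 : a * (x s + x t) + b * (y s + y t) = 0 := by linarith
    have h4 := mul_nonneg ha h1.le
    have h5 := mul_nonneg hb h2.le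
    have h6 : a = 0 := by
      by_contra h
      exact (mul_pos (lt_of_le_of_ne ha (Ne.symm h)) h1).ne' (by linarith)
    have h7 : b = 0 := by
      by_contra h
      exact (mul_pos (lt_of_le_of_ne hb (Ne.symm h)) h2).ne' (by linarith)
    linarith
  by_cases hneg : ∀ s, 0 ≤ y s
  · intro z hz
    refine racgChamber_subset_titsCone hirr hsymm (hpair z hz fun s => ?_)
    obtain ⟨a, b, ha, hb, hab, rfl⟩ := hz
    exact add_nonneg (mul_nonneg ha (hx.1 s)) (mul_nonneg hb (hneg s))
  push Not at hneg
  -- the first wall crossed by the segment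
  obtain ⟨s, hs, hmin⟩ : ∃ s, y s < 0 ∧ ∀ t, y t < 0 → x s / (x s - y s) ≤ x t / (x t - y t) := by
    obtain ⟨s, hs, hmin⟩ := Set.exists_min_image {s | y s < 0} (fun t => x t / (x t - y t))
      (Set.toFinite _) hneg
    exact ⟨s, hs, hmin⟩
  have hxs := hx.1 s
  have hpos : 0 < x s - y s := by linarith
  set τ := x s / (x s - y s) with hτ
  have hτ0 : 0 ≤ τ := div_nonneg hxs hpos.le
  have hτ1 : τ ≤ 1 := (div_le_one hpos).2 (by linarith)
  set z : S → ℝ := (1 - τ) • x + τ • y with hz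
  have hzseg : z ∈ segment ℝ x y := ⟨1 - τ, τ, by linarith, hτ0, by ring, rfl⟩
  have hzs : z s = 0 := by
    simp only [hz, Pi.add_apply, Pi.smul_apply, smul_eq_mul, hτ]
    field_simp
    ring
  have hz0 : ∀ t, 0 ≤ z t := by
    intro t
    simp only [hz, Pi.add_apply, Pi.smul_apply, smul_eq_mul]
    rcases lt_or_ge (y t) 0 with ht | ht
    · have h1 := hmin t ht
      have hxt := hx.1 t
      rw [le_div_iff₀ (by linarith)] at h1
      linarith
    · exact add_nonneg (mul_nonneg (by linarith) (hx.1 t)) (mul_nonneg hτ0 ht)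
  have hzC := hpair z hzseg hz0
  have hdesc : racgLength (racgGen adj s * w) < racgLength w := by
    rcases lt_or_gt_of_ne (racgLength_gen_mul_ne s w) with h | h
    · exact h
    · have := (racgRep_chamber_pos hirr hsymm hy w).1 s h
      rw [racgRep_apply_inv_self] at this
      linarith
  have hrec := ih _ hdesc (racgGen adj s * w) hzC (y := racgRep hirr hsymm (racgGen adj s) y)
    (by rwa [mul_inv_rev, racgRep_mul_apply, racgRep_inv_apply_self]) rfl
  intro p hp
  have hsplit : p ∈ segment ℝ x z ∪ segment ℝ z y := by
    obtain ⟨a, b, ha, hb, hab, rfl⟩ := hp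
    obtain rfl : a = 1 - b := by linarith
    rcases le_total b τ with hbt | hbt
    · left
      rcases eq_or_lt_of_le hτ0 with h0 | h0
      · obtain rfl : b = 0 := by linarith
        simpa using left_mem_segment ℝ x z
      · refine ⟨1 - b / τ, b / τ, ?_, by positivity, by ring, ?_⟩
        · rw [sub_nonneg, div_le_one h0]; exact hbt
        · ext t
          simp only [hz, Pi.add_apply, Pi.smul_apply, smul_eq_mul]
          field_simp
          ring
    · right
      rcases eq_or_lt_of_le hτ1 with h1 | h1
      · obtain rfl : b = 1 := by linarith
        simpa using right_mem_segment ℝ z y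
      · have h2 : 0 < 1 - τ := by linarith
        refine ⟨(1 - b) / (1 - τ), (b - τ) / (1 - τ), by positivity,
          div_nonneg (by linarith) h2.le, ?_, ?_⟩
        · rw [← add_div, div_eq_one_iff_eq h2.ne']; ring
        · ext t
          simp only [hz, Pi.add_apply, Pi.smul_apply, smul_eq_mul]
          field_simp
          ring
  rcases hsplit with hp | hp
  · refine racgChamber_subset_titsCone hirr hsymm (hpair p ?_ ?_)
    · exact (convex_segment x y).segment_subset (left_mem_segment ℝ x y) hzseg hp
    · obtain ⟨a, b, ha, hb, hab, rfl⟩ := hp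
      exact fun t => add_nonneg (mul_nonneg ha (hx.1 t)) (mul_nonneg hb (hz0 t))
  · have h1 : racgRep hirr hsymm (racgGen adj s) p ∈ racgTitsCone hirr hsymm := by
      apply hrec
      obtain ⟨a, b, ha, hb, hab, rfl⟩ := hp
      exact ⟨a, b, ha, hb, hab, by
        rw [map_add, map_smul, map_smul, racgRep_gen_fix hirr hsymm hzs]⟩
    have h2 := racgRep_mem_titsCone hirr hsymm (racgGen adj s)⁻¹ h1
    rwa [racgRep_inv_apply_self] at h2

theorem racgTitsCone_convex [Finite S] : Convex ℝ (racgTitsCone hirr hsymm) := by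
  rw [convex_iff_segment_subset]
  rintro x ⟨v, hv⟩ y ⟨w, hw⟩ p hp
  have h1 := racg_segment_subset_titsCone hirr hsymm (v * w⁻¹) (y := racgRep hirr hsymm v y) hv
    (by rwa [mul_inv_rev, inv_inv, racgRep_mul_apply, racgRep_inv_apply_self])
  have h2 : racgRep hirr hsymm v p ∈ racgTitsCone hirr hsymm := by
    apply h1
    obtain ⟨a, b, ha, hb, hab, rfl⟩ := hp
    exact ⟨a, b, ha, hb, hab, by rw [map_add, map_smul, map_smul]⟩
  have h3 := racgRep_mem_titsCone hirr hsymm v⁻¹ h2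
  rwa [racgRep_inv_apply_self] at h3

end TitsCone

section LocalFinite

variable {S : Type} {adj : S → S → Prop}

/-- The map folding the walls of `s` and `t` onto their nonnegative sides, for adjacent `s`, `t`. -/
noncomputable def racgFold (adj : S → S → Prop) (s t : S) (y : S → ℝ) : S → ℝ :=
  fun r => y r + max (-y s) 0 * racgCartan adj s r + max (-y t) 0 * racgCartan adj t r

theorem racgFold_continuous (s t : S) : Continuous (racgFold adj s t) := by
  unfold racgFold
  fun_prop

theorem racgFold_of_nonneg {s t : S} {y : S → ℝ} (hs : 0 ≤ y s) (ht : 0 ≤ y t) :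
    racgFold adj s t y = y := by
  ext r
  rw [racgFold, max_eq_right (by linarith), max_eq_right (by linarith)]
  ring

/-- The open star of the wall intersection of `s` and `t`. -/
def racgStar (adj : S → S → Prop) (s t : S) : Set (S → ℝ) :=
  {y | ∀ r, r ≠ s → r ≠ t → 0 < racgFold adj s t y r}

theorem racgStar_isOpen [Finite S] (s t : S) : IsOpen (racgStar adj s t) := by
  have : racgStar adj s t = ⋂ r, {y | r ≠ s → r ≠ t → 0 < racgFold adj s t y r} := by
    ext; simp [racgStar]
  rw [this]
  refine isOpen_iInter_of_finite fun r => ?_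
  by_cases h : r ≠ s ∧ r ≠ t
  · simp only [h.1, h.2, ne_eq, not_false_eq_true, forall_const]
    exact isOpen_lt continuous_const ((continuous_apply r).comp (racgFold_continuous s t))
  · convert isOpen_univ
    ext y
    simp only [Set.mem_ofPred_eq, Set.mem_univ, iff_true]
    exact fun h1 h2 => absurd ⟨h1, h2⟩ h

variable (hirr : ∀ s, ¬ adj s s) (hsymm : ∀ s t, adj s t → adj t s)

theorem racgFold_left (hirr : ∀ s, ¬ adj s s)
    (hsymm : ∀ s t, adj s t → adj t s)
    {s t : S} (hst : adj s t) (y : S → ℝ) : racgFold adj s t y s = |y s| := by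
  rw [racgFold, racgCartan_self, racgCartan_of_adj hirr (hsymm _ _ hst)]
  rcases le_total 0 (y s) with h | h
  · rw [max_eq_right (by linarith), abs_of_nonneg h]; ring
  · rw [max_eq_left (by linarith), abs_of_nonpos h]; ring

theorem racgFold_right (hirr : ∀ s, ¬ adj s s)
    {s t : S} (hst : adj s t) (y : S → ℝ) : racgFold adj s t y t = |y t| := by
  rw [racgFold, racgCartan_self, racgCartan_of_adj hirr hst, mul_zero, add_zero]
  rcases le_total 0 (y t) with h | h
  · rw [max_eq_right (by linarith), abs_of_nonneg h]; ring
  · rw [max_eq_left (by linarith), abs_of_nonpos h]; ring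

theorem racgFold_eq_rep {s t : S} (hst : adj s t) (y : S → ℝ) :
    ∃ w ∈ racgShort adj, racgFold adj s t y = racgRep hirr hsymm w y := by
  have hmem : ∀ w ∈ ({1, racgGen adj s, racgGen adj t, racgGen adj s * racgGen adj t} :
      Set (RACG adj)), w ∈ racgShort adj := fun w hw => Set.mem_iUnion.2 ⟨(s, t), hw⟩
  have h0 := racgCartan_of_adj hirr (hsymm _ _ hst)
  rcases le_total 0 (y s) with h | h <;> rcases le_total 0 (y t) with h' | h'
  · exact ⟨1, hmem _ (by simp), by rw [racgFold_of_nonneg h h']; simp⟩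
  · refine ⟨racgGen adj t, hmem _ (by simp), ?_⟩
    ext r
    rw [racgFold, max_eq_right (by linarith), max_eq_left (by linarith), racgRep_gen]
    ring
  · refine ⟨racgGen adj s, hmem _ (by simp), ?_⟩
    ext r
    rw [racgFold, max_eq_left (by linarith), max_eq_right (by linarith), racgRep_gen]
    ring
  · refine ⟨racgGen adj s * racgGen adj t, hmem _ (by simp), ?_⟩
    ext r
    rw [racgFold, max_eq_left (by linarith), max_eq_left (by linarith), racgRep_mul_apply,
      racgRep_gen, racgRep_gen, racgRep_gen, h0]
    ring

theorem racgFold_mem_chamber (hirr : ∀ s, ¬ adj s s)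
    (hsymm : ∀ s t, adj s t → adj t s)
    {s t : S} (hst : adj s t) {y : S → ℝ} (hy : y ∈ racgStar adj s t) :
    racgFold adj s t y ∈ racgChamber adj := by
  have hl := racgFold_left hirr hsymm hst y
  have hr := racgFold_right hirr hst y
  refine ⟨fun r => ?_, fun p q hpq hp hq => ?_⟩
  · by_cases h1 : r = s
    · rw [h1, hl]; positivity
    by_cases h2 : r = t
    · rw [h2, hr]; positivity
    exact (hy r h1 h2).le
  · have aux : ∀ r, racgFold adj s t y r = 0 → r = s ∨ r = t := by
      intro r h
      by_contra hcon
      push Not at hcon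
      exact (hy r hcon.1 hcon.2).ne' h
    rcases aux p hp with rfl | rfl <;> rcases aux q hq with rfl | rfl
    · exact absurd rfl hpq
    · exact hst
    · exact hsymm _ _ hst
    · exact absurd rfl hpq

/-- Every clique of a nonempty triangle-free graph without isolated vertices lies in an edge. -/
theorem racgChamber_zeros_subset [Nonempty S] (hnbr : ∀ s, ∃ t, adj s t)
    (htri : ∀ r s t, adj r s → adj s t → ¬ adj r t) {c : S → ℝ} (hc : c ∈ racgChamber adj) :
    ∃ s t, adj s t ∧ {r | c r = 0} ⊆ {s, t} := by
  by_cases h : ∃ s, c s = 0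
  · obtain ⟨s, hs⟩ := h
    by_cases h' : ∃ t, t ≠ s ∧ c t = 0
    · obtain ⟨t, hts, ht⟩ := h'
      have hst := hc.2 s t hts.symm hs ht
      refine ⟨s, t, hst, fun r hr => ?_⟩
      by_contra hcon
      simp only [Set.mem_insert_iff, Set.mem_singleton_iff, not_or] at hcon
      exact htri r s t (hc.2 r s hcon.1 hr hs) hst (hc.2 r t hcon.2 hr ht)
    · obtain ⟨t, hst⟩ := hnbr s
      refine ⟨s, t, hst, fun r hr => Or.inl ?_⟩
      by_contra hcon
      exact h' ⟨r, hcon, hr⟩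
  · obtain ⟨s⟩ := ‹Nonempty S›
    obtain ⟨t, hst⟩ := hnbr s
    exact ⟨s, t, hst, fun r hr => absurd ⟨r, hr⟩ h⟩

theorem racgChamber_mem_star (hnbr : ∀ s, ∃ t, adj s t)
    (htri : ∀ r s t, adj r s → adj s t → ¬ adj r t)
    [Nonempty S] {c : S → ℝ} (hc : c ∈ racgChamber adj) :
    ∃ s t, adj s t ∧ c ∈ racgStar adj s t := by
  obtain ⟨s, t, hst, h⟩ := racgChamber_zeros_subset hnbr htri hc
  refine ⟨s, t, hst, fun r hrs hrt => ?_⟩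
  rw [racgFold_of_nonneg (hc.1 s) (hc.1 t)]
  refine lt_of_le_of_ne (hc.1 r) fun h0 => ?_
  rcases h h0.symm with h | h
  exacts [hrs h, hrt h]

theorem racg_mem_short (hnbr : ∀ s, ∃ t, adj s t)
    (htri : ∀ r s t, adj r s → adj s t → ¬ adj r t)
    [Nonempty S] {c c' : S → ℝ} (hc : c ∈ racgChamber adj)
    (hc' : c' ∈ racgChamber adj) {w : RACG adj} (h : racgRep hirr hsymm w c = c') :
    w ∈ racgShort adj := by
  obtain ⟨s, t, hst, hZ⟩ := racgChamber_zeros_subset hnbr htri hc'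
  exact mem_racgShort_of_mem_closure hst hZ (racgRep_chamber_eq hirr hsymm hc hc' w h).2

theorem racgRep_continuous [Finite S] (w : RACG adj) : Continuous (racgRep hirr hsymm w) :=
  (racgRep hirr hsymm w).toLinearMap.continuous_of_finiteDimensional

theorem mem_racgChamber_iff {c : S → ℝ} :
    c ∈ racgChamber adj ↔ (∀ s, 0 ≤ c s) ∧ c ∈ racgTitsCone hirr hsymm := by
  refine ⟨fun h => ⟨h.1, racgChamber_subset_titsCone hirr hsymm h⟩, fun h => ⟨h.1, ?_⟩⟩
  intro s t hst hs ht
  by_contra hadj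
  have := racgTitsCone_pair_pos hirr hsymm h.2 hst hadj
  rw [hs, ht] at this
  simp at this

theorem racgChamber_convex (hirr : ∀ s, ¬ adj s s)
    (hsymm : ∀ s t, adj s t → adj t s)
    [Finite S] : Convex ℝ (racgChamber adj) := by
  have : racgChamber adj = Set.Ici 0 ∩ racgTitsCone hirr hsymm := by
    ext c
    rw [mem_racgChamber_iff hirr hsymm]
    rfl
  rw [this]
  exact (convex_Ici 0).inter (racgTitsCone_convex hirr hsymm)

/-- The chambers, as subsets of the Tits cone. -/
def racgTile (w : RACG adj) : Set (racgTitsCone hirr hsymm) :=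
  {y | racgRep hirr hsymm w y ∈ racgChamber adj}

theorem racgTile_isClosed [Finite S] (w : RACG adj) : IsClosed (racgTile hirr hsymm w) := by
  have : racgTile hirr hsymm w =
      (fun y : racgTitsCone hirr hsymm => racgRep hirr hsymm w y) ⁻¹' Set.Ici 0 := by
    ext y
    have h := racgRep_mem_titsCone hirr hsymm w y.2
    rw [racgTile, Set.mem_ofPred_eq, mem_racgChamber_iff hirr hsymm]
    exact ⟨fun h => h.1, fun h' => ⟨h', h⟩⟩
  rw [this]
  exact isClosed_Ici.preimage ((racgRep_continuous hirr hsymm w).comp continuous_subtype_val)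

theorem racgTile_iUnion : ⋃ w, racgTile hirr hsymm w = Set.univ :=
  Set.eq_univ_of_forall fun y => Set.mem_iUnion.2 y.2

theorem racgTile_locallyFinite (hnbr : ∀ s, ∃ t, adj s t)
    (htri : ∀ r s t, adj r s → adj s t → ¬ adj r t)
    [Finite S] [Nonempty S] :
    LocallyFinite (racgTile hirr hsymm) := by
  rintro ⟨y, v, hv⟩
  obtain ⟨s, t, hst, hy⟩ := racgChamber_mem_star hnbr htri hv
  refine ⟨(fun y : racgTitsCone hirr hsymm => racgRep hirr hsymm v y) ⁻¹' racgStar adj s t,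
    ((racgStar_isOpen s t).preimage
      ((racgRep_continuous hirr hsymm v).comp continuous_subtype_val)).mem_nhds hy, ?_⟩
  have hfin := Set.Finite.image2 (fun g f : RACG adj => g * f * v) (racgShort_finite (adj := adj))
    (racgShort_finite (adj := adj))
  refine hfin.subset ?_
  rintro w ⟨x, hxw, hx⟩
  obtain ⟨f, hf, hfx⟩ := racgFold_eq_rep hirr hsymm hst (racgRep hirr hsymm v x)
  have hc := racgFold_mem_chamber hirr hsymm hst hx
  refine ⟨w * v⁻¹ * f⁻¹, racg_mem_short hirr hsymm hnbr htri hc hxw ?_, f, hf, by group⟩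
  rw [hfx, racgRep_mul_apply, racgRep_inv_apply_self, racgRep_mul_apply, racgRep_inv_apply_self]

/-- The equivariant extension to the Tits cone of a map defined on the chamber. -/
noncomputable def racgExtend (R : (S → ℝ) → S → ℝ) (y : racgTitsCone hirr hsymm) : S → ℝ :=
  racgRep hirr hsymm y.2.choose⁻¹ (R (racgRep hirr hsymm y.2.choose y))

theorem racgExtend_eq {R : (S → ℝ) → S → ℝ}
    (hR : ∀ c ∈ racgChamber adj, ∀ s, c s = 0 → R c s = 0) (y : racgTitsCone hirr hsymm)
    {w : RACG adj} (hw : racgRep hirr hsymm w y ∈ racgChamber adj) :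
    racgExtend hirr hsymm R y = racgRep hirr hsymm w⁻¹ (R (racgRep hirr hsymm w y)) := by
  have hv := y.2.choose_spec
  rw [racgExtend]
  generalize y.2.choose = v at hv ⊢
  have hvw : racgRep hirr hsymm (w * v⁻¹) (racgRep hirr hsymm v y) = racgRep hirr hsymm w y := by
    rw [racgRep_mul_apply, racgRep_inv_apply_self]
  obtain ⟨h1, h2⟩ := racgRep_chamber_eq hirr hsymm hv hw _ hvw
  have h3 := racgRep_fix_of_mem_closure hirr hsymm h2 (hR _ hw)
  rw [h1]
  conv_rhs => rw [← h3]
  rw [← racgRep_mul_apply, inv_mul_cancel_left]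

theorem racgExtend_continuous (hnbr : ∀ s, ∃ t, adj s t)
    (htri : ∀ r s t, adj r s → adj s t → ¬ adj r t)
    [Finite S] [Nonempty S] {R : (S → ℝ) → S → ℝ}
    (hR : ∀ c ∈ racgChamber adj, ∀ s, c s = 0 → R c s = 0)
    (hcont : ContinuousOn R (racgChamber adj)) : Continuous (racgExtend hirr hsymm R) := by
  refine (racgTile_locallyFinite hirr hsymm hnbr htri).continuous (racgTile_iUnion hirr hsymm)
    (racgTile_isClosed hirr hsymm) fun w => ?_
  refine ContinuousOn.congr (f := fun y : racgTitsCone hirr hsymm =>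
    racgRep hirr hsymm w⁻¹ (R (racgRep hirr hsymm w y))) ?_
    fun y hy => racgExtend_eq hirr hsymm hR y hy
  refine (racgRep_continuous hirr hsymm w⁻¹).comp_continuousOn (hcont.comp ?_ fun y hy => hy)
  exact ((racgRep_continuous hirr hsymm w).comp continuous_subtype_val).continuousOn

end LocalFinite

section Slice

variable {S : Type} {adj : S → S → Prop}

/-- The centre of mass of the points `p e`, indexed by the edges `e`, with the weight of `e` being
the product of the coordinates outside `e`. -/
noncomputable def racgRetract [Fintype S] (adj : S → S → Prop) (p : S × S → S → ℝ)
    (c : S → ℝ) : S → ℝ :=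
  (Finset.univ.filter fun e : S × S => adj e.1 e.2).centerMass
    (fun e => ∏ r ∈ Finset.univ.filter (fun r => r ≠ e.1 ∧ r ≠ e.2), c r) p

section Retract

variable [Fintype S] {c : S → ℝ}

theorem racgRetract_weight_nonneg (hc : c ∈ racgChamber adj) (e : S × S) :
    0 ≤ ∏ r ∈ Finset.univ.filter (fun r => r ≠ e.1 ∧ r ≠ e.2), c r :=
  Finset.prod_nonneg fun r _ => hc.1 r

theorem racgRetract_weight_sum_pos [Nonempty S] (hnbr : ∀ s, ∃ t, adj s t)
    (htri : ∀ r s t, adj r s → adj s t → ¬ adj r t) (hc : c ∈ racgChamber adj) :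
    0 < ∑ e ∈ Finset.univ.filter (fun e : S × S => adj e.1 e.2),
      ∏ r ∈ Finset.univ.filter (fun r => r ≠ e.1 ∧ r ≠ e.2), c r := by
  obtain ⟨s, t, hst, hZ⟩ := racgChamber_zeros_subset hnbr htri hc
  refine Finset.sum_pos' (fun e _ => racgRetract_weight_nonneg hc e)
    ⟨(s, t), by simpa using hst, Finset.prod_pos fun r hr => ?_⟩
  simp only [Finset.mem_filter, Finset.mem_univ, true_and] at hr
  refine lt_of_le_of_ne (hc.1 r) fun h0 => ?_
  rcases hZ h0.symm with h | h
  exacts [hr.1 h, hr.2 h]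

theorem racgRetract_mem [Nonempty S] (hnbr : ∀ s, ∃ t, adj s t)
    (htri : ∀ r s t, adj r s → adj s t → ¬ adj r t) (hc : c ∈ racgChamber adj)
    {B : Set (S → ℝ)} (hB : Convex ℝ B) {p : S × S → S → ℝ}
    (hp : ∀ e, adj e.1 e.2 → p e ∈ B) : racgRetract adj p c ∈ B :=
  hB.centerMass_mem (fun e _ => racgRetract_weight_nonneg hc e)
    (racgRetract_weight_sum_pos hnbr htri hc) fun e he => hp e (by simpa using he)

theorem racgRetract_eq_zero {p : S × S → S → ℝ}
    (hp : ∀ e, adj e.1 e.2 → p e e.1 = 0 ∧ p e e.2 = 0) {s : S} (hs : c s = 0) :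
    racgRetract adj p c s = 0 := by
  rw [racgRetract, Finset.centerMass, Pi.smul_apply, Finset.sum_apply]
  refine smul_eq_zero_of_right _ (Finset.sum_eq_zero fun e he => ?_)
  have he' : adj e.1 e.2 := by simpa using he
  rw [Pi.smul_apply, smul_eq_mul]
  by_cases h1 : s = e.1
  · rw [h1, (hp e he').1, mul_zero]
  by_cases h2 : s = e.2
  · rw [h2, (hp e he').2, mul_zero]
  rw [Finset.prod_eq_zero (i := s) (by simp [h1, h2]) hs, zero_mul]

theorem racgRetract_continuousOn [Nonempty S] (hnbr : ∀ s, ∃ t, adj s t)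
    (htri : ∀ r s t, adj r s → adj s t → ¬ adj r t) (p : S × S → S → ℝ) :
    ContinuousOn (racgRetract adj p) (racgChamber adj) := by
  unfold racgRetract Finset.centerMass
  refine ContinuousOn.smul (ContinuousOn.inv₀ (Continuous.continuousOn (by fun_prop))
    fun c hc => (racgRetract_weight_sum_pos hnbr htri hc).ne') (Continuous.continuousOn ?_)
  fun_prop

end Retract

variable (hirr : ∀ s, ¬ adj s s) (hsymm : ∀ s t, adj s t → adj t s)

/-- The union of the translates of the slice of the chamber by the set `A`. -/
def racgSlice (A : Set (S → ℝ)) : Set (S → ℝ) :=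
  {y | ∃ w : RACG adj, racgRep hirr hsymm w y ∈ racgChamber adj ∩ A}

variable {A : Set (S → ℝ)}

theorem racgSlice_subset : racgSlice hirr hsymm A ⊆ racgTitsCone hirr hsymm :=
  fun _ ⟨w, hw⟩ => ⟨w, hw.1⟩

theorem racgRep_mem_slice (w : RACG adj) {y : S → ℝ} (hy : y ∈ racgSlice hirr hsymm A) :
    racgRep hirr hsymm w y ∈ racgSlice hirr hsymm A := by
  obtain ⟨v, hv⟩ := hy
  exact ⟨v * w⁻¹, by rwa [racgRep_mul_apply, racgRep_inv_apply_self]⟩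

theorem racgSlice_mem_of_mem_chamber {y : S → ℝ} (hy : y ∈ racgSlice hirr hsymm A)
    (hc : y ∈ racgChamber adj) : y ∈ A := by
  obtain ⟨v, hv⟩ := hy
  rw [(racgRep_chamber_eq hirr hsymm hc hv.1 v rfl).1]
  exact hv.2

/-- The action of the group on the slice. -/
noncomputable abbrev racgSliceAction (A : Set (S → ℝ)) :
    MulAction (RACG adj) (racgSlice hirr hsymm A) where
  smul w y := ⟨racgRep hirr hsymm w y, racgRep_mem_slice hirr hsymm w y.2⟩
  one_smul y := Subtype.ext (by
    change racgRep hirr hsymm 1 y = y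
    simp)
  mul_smul v w y := Subtype.ext (racgRep_mul_apply hirr hsymm v w y)

theorem racgSliceAction_properlyDiscontinuous [Finite S] [Nonempty S] (hnbr : ∀ s, ∃ t, adj s t)
    (htri : ∀ r s t, adj r s → adj s t → ¬ adj r t) (A : Set (S → ℝ)) :
    @ProperlyDiscontinuousSMul (RACG adj) (racgSlice hirr hsymm A) _
      (racgSliceAction hirr hsymm A).toSMul := by
  let _ := racgSliceAction hirr hsymm A
  have hlf := (racgTile_locallyFinite hirr hsymm hnbr htri).preimage_continuous
    (continuous_inclusion (racgSlice_subset hirr hsymm (A := A)))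
  refine ⟨fun {K L} hK hL => ?_⟩
  have hKf := hlf.finite_nonempty_inter_compact hK
  have hLf := hlf.finite_nonempty_inter_compact hL
  have hfin := Set.Finite.image2 (fun u v : RACG adj => u * v)
    (Set.Finite.image2 (fun u v : RACG adj => u⁻¹ * v) hLf (racgShort_finite (adj := adj))) hKf
  refine hfin.subset ?_
  rintro g ⟨_, ⟨y, hyK, rfl⟩, hyL⟩
  obtain ⟨v, hv⟩ := racgSlice_subset hirr hsymm y.2
  obtain ⟨u, hu⟩ := racgSlice_subset hirr hsymm (g • y).2
  refine ⟨u⁻¹ * (u * g * v⁻¹), ⟨u, ⟨_, hu, hyL⟩, u * g * v⁻¹, ?_, rfl⟩, v, ⟨y, hv, hyK⟩,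
    by group⟩
  refine racg_mem_short hirr hsymm hnbr htri hv hu ?_
  rw [racgRep_mul_apply, racgRep_inv_apply_self, racgRep_mul_apply]
  rfl

theorem racgSlice_contractible [Fintype S] [Nonempty S] (hnbr : ∀ s, ∃ t, adj s t)
    (htri : ∀ r s t, adj r s → adj s t → ¬ adj r t) (hA : Convex ℝ A) {p : S × S → S → ℝ}
    (hpA : ∀ e, adj e.1 e.2 → p e ∈ racgChamber adj ∩ A)
    (hp : ∀ e, adj e.1 e.2 → p e e.1 = 0 ∧ p e e.2 = 0) :
    ContractibleSpace (racgSlice hirr hsymm A) := by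
  have hB : Convex ℝ (racgChamber adj ∩ A) := (racgChamber_convex hirr hsymm).inter hA
  have hR0 : ∀ c ∈ racgChamber adj, ∀ s, c s = 0 → racgRetract adj p c s = 0 :=
    fun c _ s hs => racgRetract_eq_zero hp hs
  have hRB : ∀ c ∈ racgChamber adj, racgRetract adj p c ∈ racgChamber adj ∩ A :=
    fun c hc => racgRetract_mem hnbr htri hc hB hpA
  have hcont := racgExtend_continuous hirr hsymm hnbr htri hR0
    (racgRetract_continuousOn hnbr htri p)
  have hmem : ∀ y : racgTitsCone hirr hsymm,
      racgExtend hirr hsymm (racgRetract adj p) y ∈ racgSlice hirr hsymm A := by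
    rintro ⟨y, w, hw⟩
    refine ⟨w, ?_⟩
    rw [racgExtend_eq hirr hsymm hR0 _ hw, racgRep_apply_inv_self]
    exact hRB _ hw
  let ι : C(racgSlice hirr hsymm A, racgTitsCone hirr hsymm) :=
    ⟨_, continuous_inclusion (racgSlice_subset hirr hsymm)⟩
  let ρ : C(racgTitsCone hirr hsymm, racgSlice hirr hsymm A) :=
    ⟨fun y => ⟨_, hmem y⟩, hcont.subtype_mk _⟩
  have hne : (racgTitsCone hirr hsymm).Nonempty := by
    obtain ⟨s⟩ := ‹Nonempty S›
    obtain ⟨t, hst⟩ := hnbr s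
    exact ⟨_, racgChamber_subset_titsCone hirr hsymm (hpA (s, t) hst).1⟩
  have : ContractibleSpace (racgTitsCone hirr hsymm) :=
    (racgTitsCone_convex hirr hsymm).contractibleSpace hne
  have hnull : (ρ.comp ι).Nullhomotopic := by
    have := ((id_nullhomotopic (racgTitsCone hirr hsymm)).comp_right ρ).comp_left ι
    simpa using this
  rw [contractible_iff_id_nullhomotopic]
  obtain ⟨q, hq⟩ := hnull
  refine ⟨q, ContinuousMap.Homotopic.trans ?_ hq⟩
  have hline : ∀ x : unitInterval × racgSlice hirr hsymm A,
      (1 - (x.1 : ℝ)) • (x.2 : S → ℝ) + (x.1 : ℝ) • (ρ (ι x.2) : S → ℝ) ∈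
        racgSlice hirr hsymm A := by
    rintro ⟨a, y, w, hw⟩
    refine ⟨w, ?_⟩
    have h1 : racgRep hirr hsymm w (ρ (ι ⟨y, w, hw⟩) : S → ℝ) =
        racgRetract adj p (racgRep hirr hsymm w y) := by
      change racgRep hirr hsymm w (racgExtend hirr hsymm (racgRetract adj p) _) = _
      rw [racgExtend_eq hirr hsymm hR0 _ hw.1, racgRep_apply_inv_self]
      rfl
    rw [map_add, map_smul, map_smul, h1]
    exact hB hw (hRB _ hw.1) (sub_nonneg.2 a.2.2) a.2.1 (by ring)
  exact ⟨{
    toFun := fun x => ⟨_, hline x⟩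
    continuous_toFun := by
      refine Continuous.subtype_mk ?_ _
      have := (continuous_subtype_val.comp (ρ.comp ι).continuous).comp
        (continuous_snd (X := unitInterval) (Y := racgSlice hirr hsymm A))
      refine Continuous.add ?_ (Continuous.smul
        (continuous_subtype_val.comp continuous_fst) this)
      fun_prop
    map_zero_left := fun y => Subtype.ext (by simp)
    map_one_left := fun y => Subtype.ext (by simp) }⟩

/-- The slice is locally Euclidean if adjacent coordinates extend to global coordinates of `A`. -/
theorem racgSlice_locallyEuclidean [Finite S] [Nonempty S] (hnbr : ∀ s, ∃ t, adj s t)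
    (htri : ∀ r s t, adj r s → adj s t → ¬ adj r t)
    (hchart : ∀ s t, adj s t → ∃ (φ : ℝ × ℝ × ℝ → S → ℝ) (g : (S → ℝ) → ℝ),
      Continuous φ ∧ Continuous g ∧
      (∀ v, φ v ∈ A ∧ φ v s = v.1 ∧ φ v t = v.2.1 ∧ g (φ v) = v.2.2) ∧
      ∀ y ∈ A, φ (y s, y t, g y) = y) (x : racgSlice hirr hsymm A) :
    ∃ (U : Set (racgSlice hirr hsymm A)) (V : Set (ℝ × ℝ × ℝ)),
      x ∈ U ∧ IsOpen U ∧ IsOpen V ∧ Nonempty (U ≃ₜ V) := by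
  obtain ⟨w, hw⟩ := x.2
  obtain ⟨s, t, hst, hx⟩ := racgChamber_mem_star hnbr htri hw.1
  obtain ⟨φ, g, hφ, hg, hv, hy⟩ := hchart s t hst
  have hts := hsymm _ _ hst
  have hcw := racgRep_continuous hirr hsymm w
  have hcw' := racgRep_continuous hirr hsymm w⁻¹
  have hcf := racgFold_continuous (adj := adj) s t
  let a : ℝ × ℝ × ℝ → ℝ × ℝ × ℝ := fun v => (|v.1|, |v.2.1|, v.2.2)
  have ha : Continuous a := by fun_prop
  let Φ : ℝ × ℝ × ℝ → S → ℝ := fun v r => φ (a v) r - max (-v.1) 0 * racgCartan adj s r -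
    max (-v.2.1) 0 * racgCartan adj t r
  have hΦ : Continuous Φ := by fun_prop
  have hneg : ∀ b : ℝ, |b| - max (-b) 0 * 2 = b := fun b => by
    rcases le_total 0 b with h | h
    · rw [max_eq_right (by linarith), abs_of_nonneg h]; ring
    · rw [max_eq_left (by linarith), abs_of_nonpos h]; ring
  have hΦs : ∀ v, Φ v s = v.1 := fun v => by
    simp only [Φ, racgCartan_self, racgCartan_of_adj hirr hts, (hv _).2.1, a]
    linarith [hneg v.1]
  have hΦt : ∀ v, Φ v t = v.2.1 := fun v => by
    simp only [Φ, racgCartan_self, racgCartan_of_adj hirr hst, (hv _).2.2.1, a]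
    linarith [hneg v.2.1]
  have hfold : ∀ v, racgFold adj s t (Φ v) = φ (a v) := fun v => by
    ext r
    rw [racgFold, hΦs, hΦt]
    simp only [Φ]
    ring
  let O : Set (ℝ × ℝ × ℝ) := Φ ⁻¹' racgStar adj s t
  let U : Set (racgSlice hirr hsymm A) := (fun y => racgRep hirr hsymm w y) ⁻¹' racgStar adj s t
  have hUA : ∀ y ∈ U, racgFold adj s t (racgRep hirr hsymm w y) ∈ A := fun y hyU => by
    refine racgSlice_mem_of_mem_chamber hirr hsymm ?_ (racgFold_mem_chamber hirr hsymm hst hyU)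
    obtain ⟨f, -, hf⟩ := racgFold_eq_rep hirr hsymm hst (racgRep hirr hsymm w y)
    rw [hf]
    exact racgRep_mem_slice _ _ _ (racgRep_mem_slice _ _ _ y.2)
  let ψ : (S → ℝ) → ℝ × ℝ × ℝ := fun u => (u s, u t, g (racgFold adj s t u))
  have hψ : Continuous ψ := by fun_prop
  have hψΦ : ∀ v, ψ (Φ v) = v := fun v => by
    simp only [ψ, hΦs, hΦt, hfold, (hv _).2.2.2, a]
  have hΦψ : ∀ u, racgFold adj s t u ∈ A → Φ (ψ u) = u := fun u hu => by
    ext r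
    have h1 := hy _ hu
    rw [racgFold_left hirr hsymm hst, racgFold_right hirr hst] at h1
    simp only [Φ, ψ, a, h1]
    rw [racgFold]
    ring
  have hslice : ∀ v ∈ O, racgRep hirr hsymm w⁻¹ (Φ v) ∈ racgSlice hirr hsymm A := fun v hvO => by
    apply racgRep_mem_slice
    obtain ⟨f, -, hf⟩ := racgFold_eq_rep hirr hsymm hst (Φ v)
    refine ⟨f, ?_⟩
    rw [← hf]
    exact ⟨racgFold_mem_chamber hirr hsymm hst hvO, hfold v ▸ (hv _).1⟩
  refine ⟨U, O, hx, (racgStar_isOpen s t).preimage (hcw.comp continuous_subtype_val),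
    (racgStar_isOpen s t).preimage hΦ, ⟨{
      toFun := fun y => ⟨ψ (racgRep hirr hsymm w y), ?_⟩
      invFun := fun v => ⟨⟨racgRep hirr hsymm w⁻¹ (Φ v), hslice v v.2⟩, ?_⟩
      left_inv := ?_
      right_inv := ?_
      continuous_toFun := ?_
      continuous_invFun := ?_ }⟩⟩
  · change Φ (ψ (racgRep hirr hsymm w y)) ∈ racgStar adj s t
    rw [hΦψ _ (hUA _ y.2)]
    exact y.2
  · change racgRep hirr hsymm w (racgRep hirr hsymm w⁻¹ (Φ v)) ∈ racgStar adj s t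
    rw [racgRep_apply_inv_self]
    exact v.2
  · intro y
    refine Subtype.ext (Subtype.ext ?_)
    change racgRep hirr hsymm w⁻¹ (Φ (ψ (racgRep hirr hsymm w y))) = y
    rw [hΦψ _ (hUA _ y.2), racgRep_inv_apply_self]
  · intro v
    refine Subtype.ext ?_
    change ψ (racgRep hirr hsymm w (racgRep hirr hsymm w⁻¹ (Φ v))) = v
    rw [racgRep_apply_inv_self, hψΦ]
  · exact (hψ.comp (hcw.comp (continuous_subtype_val.comp continuous_subtype_val))).subtype_mk _
  · exact ((hcw'.comp (hΦ.comp continuous_subtype_val)).subtype_mk _).subtype_mk _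

end Slice

/-- A right-angled Coxeter group whose nerve is a triangle-free graph acts properly
discontinuously on a contractible 3-manifold if that graph is realized by faces and edges of a
three-dimensional polyhedron, here given as the slice of the positive orthant by `A`. -/
theorem racg_acts_on_contractible_3manifold {S : Type} [Fintype S] [Nonempty S]
    {adj : S → S → Prop} (hirr : ∀ s, ¬ adj s s) (hsymm : ∀ s t, adj s t → adj t s)
    (hnbr : ∀ s, ∃ t, adj s t) (htri : ∀ r s t, adj r s → adj s t → ¬ adj r t)
    {A : Set (S → ℝ)} (hA : Convex ℝ A)
    (hedge : ∀ e : S × S, adj e.1 e.2 → ∃ p ∈ A, p e.1 = 0 ∧ p e.2 = 0 ∧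
      ∀ r, r ≠ e.1 → r ≠ e.2 → 0 < p r)
    (hchart : ∀ s t, adj s t → ∃ (φ : ℝ × ℝ × ℝ → S → ℝ) (g : (S → ℝ) → ℝ),
      Continuous φ ∧ Continuous g ∧
      (∀ v, φ v ∈ A ∧ φ v s = v.1 ∧ φ v t = v.2.1 ∧ g (φ v) = v.2.2) ∧
      ∀ y ∈ A, φ (y s, y t, g y) = y) :
    ∃ (M : Type) (_ : TopologicalSpace M),
      IsTopological3Manifold M ∧ ContractibleSpace M ∧
      ∃ _ : MulAction (RACG adj) M,
        (∀ γ : RACG adj, Continuous fun x : M => γ • x) ∧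
        ProperlyDiscontinuousSMul (RACG adj) M := by
  choose! p hpA hp1 hp2 hp0 using hedge
  have hpC : ∀ e, adj e.1 e.2 → p e ∈ racgChamber adj ∩ A := by
    refine fun e he => ⟨?_, hpA e he⟩
    have hfold : racgFold adj e.1 e.2 (p e) = p e :=
      racgFold_of_nonneg (hp1 e he).ge (hp2 e he).ge
    rw [← hfold]
    refine racgFold_mem_chamber hirr hsymm he fun r h1 h2 => ?_
    rw [hfold]
    exact hp0 e he r h1 h2
  have hcontr := racgSlice_contractible hirr hsymm hnbr htri hA hpC
    fun e he => ⟨hp1 e he, hp2 e he⟩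
  refine ⟨racgSlice hirr hsymm A, inferInstance, ⟨inferInstance, inferInstance, inferInstance,
    racgSlice_locallyEuclidean hirr hsymm hnbr htri hchart⟩, hcontr,
    racgSliceAction hirr hsymm A, fun γ => ?_,
    racgSliceAction_properlyDiscontinuous hirr hsymm hnbr htri A⟩
  exact ((racgRep_continuous hirr hsymm γ).comp continuous_subtype_val).subtype_mk _

section PlaneArrangement

variable {S : Type}

/-- The image of `ℝ³` under the heights above the planes `z = u s * x + v s * y + q s`. -/
def planeSlice (u v q : S → ℝ) : Set (S → ℝ) :=
  {p | ∃ x y z : ℝ, ∀ s, p s = z - (u s * x + v s * y + q s)}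

theorem planeSlice_convex (u v q : S → ℝ) : Convex ℝ (planeSlice u v q) := by
  rintro p ⟨x, y, z, hp⟩ p' ⟨x', y', z', hp'⟩ a b _ _ hab
  refine ⟨a * x + b * x', a * y + b * y', a * z + b * z', fun s => ?_⟩
  obtain rfl : a = 1 - b := by linarith
  simp only [Pi.add_apply, Pi.smul_apply, smul_eq_mul, hp, hp']
  ring

theorem planeSlice_chart {u v q : S → ℝ} {X Y : (S → ℝ) → ℝ} (hX : Continuous X)
    (hY : Continuous Y)
    (hXY : ∀ (p : S → ℝ) (x y z : ℝ), (∀ s, p s = z - (u s * x + v s * y + q s)) →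
      X p = x ∧ Y p = y)
    {s t : S} (hst : u s ≠ u t) :
    ∃ (φ : ℝ × ℝ × ℝ → S → ℝ) (g : (S → ℝ) → ℝ), Continuous φ ∧ Continuous g ∧
      (∀ w, φ w ∈ planeSlice u v q ∧ φ w s = w.1 ∧ φ w t = w.2.1 ∧ g (φ w) = w.2.2) ∧
      ∀ p ∈ planeSlice u v q, φ (p s, p t, g p) = p := by
  obtain ⟨du, hdu⟩ : ∃ du, du = u t - u s := ⟨_, rfl⟩
  obtain ⟨dv, hdv⟩ : ∃ dv, dv = v t - v s := ⟨_, rfl⟩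
  obtain ⟨dq, hdq⟩ : ∃ dq, dq = q t - q s := ⟨_, rfl⟩
  have hQ : du ^ 2 + dv ^ 2 ≠ 0 := by
    have : du ≠ 0 := by rw [hdu]; exact sub_ne_zero.2 hst.symm
    positivity
  let x : ℝ × ℝ × ℝ → ℝ := fun w =>
    (du * (w.1 - w.2.1 - dq) - dv * w.2.2) / (du ^ 2 + dv ^ 2)
  let y : ℝ × ℝ × ℝ → ℝ := fun w =>
    (dv * (w.1 - w.2.1 - dq) + du * w.2.2) / (du ^ 2 + dv ^ 2)
  have hx : Continuous x := by fun_prop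
  have hy : Continuous y := by fun_prop
  have hxy1 : ∀ w, du * x w + dv * y w = w.1 - w.2.1 - dq := fun w => by
    simp only [x, y]; field_simp; ring
  have hxy2 : ∀ w, -dv * x w + du * y w = w.2.2 := fun w => by
    simp only [x, y]; field_simp; ring
  have ht : ∀ a b : ℝ, u t * a + v t * b + q t =
      u s * a + v s * b + q s + (du * a + dv * b) + dq := fun a b => by
    rw [hdu, hdv, hdq]; ring
  let φ : ℝ × ℝ × ℝ → S → ℝ := fun w r =>
    w.1 + (u s * x w + v s * y w + q s) - (u r * x w + v r * y w + q r)
  have hφ : ∀ w, X (φ w) = x w ∧ Y (φ w) = y w := fun w => hXY _ _ _ _ fun r => rfl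
  refine ⟨φ, fun p => -dv * X p + du * Y p, by fun_prop, by fun_prop,
    fun w => ⟨⟨_, _, _, fun r => rfl⟩, ?_, ?_, ?_⟩, ?_⟩
  · simp only [φ]; ring
  · simp only [φ, ht, hxy1]; ring
  · beta_reduce
    rw [(hφ w).1, (hφ w).2, hxy2]
  · rintro p ⟨a, b, c, hp⟩
    obtain ⟨hXa, hYb⟩ := hXY p a b c hp
    have hxa : x (p s, p t, -dv * X p + du * Y p) = a := by
      simp only [x, hXa, hYb, hp, ht]; field_simp; ring
    have hyb : y (p s, p t, -dv * X p + du * Y p) = b := by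
      simp only [y, hXa, hYb, hp, ht]; field_simp; ring
    ext r
    simp only [φ]
    rw [hxa, hyb, hp s, hp r]
    ring

end PlaneArrangement

section Theta

variable {k : ℕ} {n : Fin k → ℕ}

theorem thetaAdj_irrefl (s : ThetaVertex n) : ¬ ThetaAdj n s s := by
  rcases s with e | ⟨i, j⟩ <;> simp [ThetaAdj]

theorem thetaAdj_symm (s t : ThetaVertex n) (h : ThetaAdj n s t) : ThetaAdj n t s := by
  rcases s with e | ⟨i, j⟩ <;> rcases t with e' | ⟨i', j'⟩ <;> simp only [ThetaAdj] at h ⊢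
  · exact h
  · exact h
  · exact ⟨h.1.symm, h.2.symm⟩

theorem thetaAdj_triangle_free (r s t : ThetaVertex n) (h : ThetaAdj n r s) (h' : ThetaAdj n s t) :
    ¬ ThetaAdj n r t := by
  intro h''
  rcases r with e | ⟨i, j⟩ <;> rcases s with e' | ⟨i', j'⟩ <;> rcases t with e'' | ⟨i'', j''⟩ <;>
    simp only [ThetaAdj] at h h' h''
  · obtain ⟨h1, h2⟩ := h'
    obtain rfl := Fin.ext h1
    rcases h with ⟨h, h3⟩ | ⟨h, h3⟩ <;> rcases h'' with ⟨h4, h5⟩ | ⟨h4, h5⟩ <;>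
      first | omega | simp_all
  · obtain ⟨h1, h2⟩ := h''
    obtain rfl := Fin.ext h1
    rcases h with ⟨h, h3⟩ | ⟨h, h3⟩ <;> rcases h' with ⟨h4, h5⟩ | ⟨h4, h5⟩ <;>
      first | omega | simp_all
  · obtain ⟨h1, h2⟩ := h
    obtain rfl := Fin.ext h1
    rcases h' with ⟨h, h3⟩ | ⟨h, h3⟩ <;> rcases h'' with ⟨h4, h5⟩ | ⟨h4, h5⟩ <;>
      first | omega | simp_all
  · omega

theorem thetaAdj_exists (hk : 0 < k) (hn : ∀ i, 1 ≤ n i) (s : ThetaVertex n) :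
    ∃ t, ThetaAdj n s t := by
  rcases s with (_ | _) | ⟨i, j⟩
  · exact ⟨Sum.inr ⟨⟨0, hk⟩, ⟨n ⟨0, hk⟩ - 1, by have := hn ⟨0, hk⟩; omega⟩⟩, by simp [ThetaAdj]⟩
  · exact ⟨Sum.inr ⟨⟨0, hk⟩, ⟨0, by have := hn ⟨0, hk⟩; omega⟩⟩, by simp [ThetaAdj]⟩
  · by_cases h : (j : ℕ) = 0
    · exact ⟨Sum.inl true, by simp [ThetaAdj, h]⟩
    · exact ⟨Sum.inr ⟨i, ⟨j - 1, by omega⟩⟩, by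
        refine ⟨rfl, Or.inr ?_⟩
        change (j : ℕ) = (j : ℕ) - 1 + 1
        omega⟩

/-- The `x`-slope of the plane attached to a vertex. -/
def thetaSlopeX (K : ℝ) : ThetaVertex n → ℝ
  | Sum.inl true => -2
  | Sum.inl false => K
  | Sum.inr ⟨_, j⟩ => 2 * (j : ℕ)

/-- The `y`-slope of the plane attached to a vertex. -/
def thetaSlopeY (L : ℝ) : ThetaVertex n → ℝ
  | Sum.inl _ => 0
  | Sum.inr ⟨i, _⟩ => 2 * L * (i : ℕ)

/-- The height over the origin of the plane attached to a vertex. -/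
def thetaHeight (K L N : ℝ) : ThetaVertex n → ℝ
  | Sum.inl true => 0
  | Sum.inl false => -(K * N)
  | Sum.inr ⟨i, j⟩ => -((j : ℕ) ^ 2 + L ^ 2 * (i : ℕ) ^ 2)

theorem one_le_sq_cast_sub {a b : ℕ} (h : a ≠ b) : 1 ≤ ((a : ℝ) - b) ^ 2 := by
  have h1 : (1 : ℤ) ≤ ((a : ℤ) - b) ^ 2 := by
    have : (a : ℤ) - b ≠ 0 := by omega
    have := sq_nonneg ((a : ℤ) - b)
    have h3 : ((a : ℤ) - b) ^ 2 ≠ 0 := pow_ne_zero 2 (by omega)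
    omega
  exact_mod_cast h1

/-- A point on the edge between the faces of the essential vertex `true` and of the first vertex of
a path. -/
theorem thetaEdge_first {K L N : ℝ} (hK : 0 < K) (hL : 0 < L) (hN : 0 < N) (i : Fin k)
    (j : Fin (n i)) (hj : (j : ℕ) = 0) :
    ∃ p ∈ planeSlice (thetaSlopeX K) (thetaSlopeY L) (thetaHeight (n := n) K L N),
      p (Sum.inl true) = 0 ∧ p (Sum.inr ⟨i, j⟩) = 0 ∧
      ∀ r, r ≠ Sum.inl true → r ≠ Sum.inr ⟨i, j⟩ → 0 < p r := by
  refine ⟨_, ⟨-(L ^ 2 * (i : ℕ) ^ 2 / 2), L * (i : ℕ), L ^ 2 * (i : ℕ) ^ 2, fun s => rfl⟩, ?_, ?_,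
    ?_⟩
  · simp only [thetaSlopeX, thetaSlopeY, thetaHeight]; ring
  · simp only [thetaSlopeX, thetaSlopeY, thetaHeight, hj]; push_cast; ring
  · rintro ((_ | _) | ⟨i', j'⟩) h1 h2
    · simp only [thetaSlopeX, thetaSlopeY, thetaHeight]
      have h3 : 0 < K * N := mul_pos hK hN
      have h4 : 0 ≤ K * (L ^ 2 * (i : ℕ) ^ 2) := by positivity
      have h5 : 0 ≤ L ^ 2 * ((i : ℕ) : ℝ) ^ 2 := by positivity
      linarith
    · exact absurd rfl h1
    · have hval : L ^ 2 * (i : ℕ) ^ 2 - (2 * ((j' : ℕ) : ℝ) * -(L ^ 2 * (i : ℕ) ^ 2 / 2) +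
          2 * L * (i' : ℕ) * (L * (i : ℕ)) + -((j' : ℕ) ^ 2 + L ^ 2 * (i' : ℕ) ^ 2)) =
          L ^ 2 * ((i : ℕ) - (i' : ℕ) : ℝ) ^ 2 + L ^ 2 * (i : ℕ) ^ 2 * (j' : ℕ) + (j' : ℕ) ^ 2 := by
        ring
      simp only [thetaSlopeX, thetaSlopeY, thetaHeight]
      rw [hval]
      by_cases hi : (i : ℕ) = i'
      · obtain rfl := Fin.ext hi
        have hj' : (j' : ℕ) ≠ 0 := fun h => h2 (by
          rw [Fin.ext (hj.trans h.symm)])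
        have : (0 : ℝ) < (j' : ℕ) := by exact_mod_cast Nat.pos_of_ne_zero hj'
        positivity
      · have := one_le_sq_cast_sub hi
        have h3 : 0 < L ^ 2 * ((i : ℕ) - (i' : ℕ) : ℝ) ^ 2 := mul_pos (by positivity) (by linarith)
        positivity

/-- A point on the edge between the faces of consecutive vertices of a path. -/
theorem thetaEdge_middle {K L N : ℝ} (hK : 0 < K) (hL : 0 < L) (hN : ∀ i, (n i : ℝ) ≤ N)
    (i : Fin k) (j j₁ : Fin (n i)) (hj : (j₁ : ℕ) = j + 1) :
    ∃ p ∈ planeSlice (thetaSlopeX K) (thetaSlopeY L) (thetaHeight (n := n) K L N),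
      p (Sum.inr ⟨i, j⟩) = 0 ∧ p (Sum.inr ⟨i, j₁⟩) = 0 ∧
      ∀ r, r ≠ Sum.inr ⟨i, j⟩ → r ≠ Sum.inr ⟨i, j₁⟩ → 0 < p r := by
  refine ⟨_, ⟨(j : ℕ) + 1 / 2, L * (i : ℕ), L ^ 2 * (i : ℕ) ^ 2 + (j : ℕ) * ((j : ℕ) + 1),
    fun s => rfl⟩, ?_, ?_, ?_⟩
  · simp only [thetaSlopeX, thetaSlopeY, thetaHeight]; ring
  · simp only [thetaSlopeX, thetaSlopeY, thetaHeight, hj]; push_cast; ring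
  · rintro ((_ | _) | ⟨i', j'⟩) h1 h2
    · simp only [thetaSlopeX, thetaSlopeY, thetaHeight]
      have h3 : ((j : ℕ) : ℝ) + 1 ≤ N := by
        refine le_trans ?_ (hN i)
        exact_mod_cast j.2
      have h4 : 0 < K * (N - ((j : ℕ) + 1 / 2)) := mul_pos hK (by linarith)
      have h5 : 0 ≤ L ^ 2 * ((i : ℕ) : ℝ) ^ 2 := by positivity
      have h6 : (0 : ℝ) ≤ (j : ℕ) * ((j : ℕ) + 1) := by positivity
      linarith
    · simp only [thetaSlopeX, thetaSlopeY, thetaHeight]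
      have h5 : 0 ≤ L ^ 2 * ((i : ℕ) : ℝ) ^ 2 := by positivity
      have h6 : (0 : ℝ) ≤ (j : ℕ) * ((j : ℕ) + 1) := by positivity
      have h7 : (0 : ℝ) ≤ (j : ℕ) := by positivity
      linarith
    · have hval : L ^ 2 * (i : ℕ) ^ 2 + (j : ℕ) * ((j : ℕ) + 1) -
          (2 * ((j' : ℕ) : ℝ) * ((j : ℕ) + 1 / 2) +
          2 * L * (i' : ℕ) * (L * (i : ℕ)) + -((j' : ℕ) ^ 2 + L ^ 2 * (i' : ℕ) ^ 2)) =
          L ^ 2 * ((i : ℕ) - (i' : ℕ) : ℝ) ^ 2 +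
            ((j : ℕ) - (j' : ℕ) : ℝ) * ((j : ℕ) + 1 - (j' : ℕ)) := by
        ring
      simp only [thetaSlopeX, thetaSlopeY, thetaHeight]
      rw [hval]
      have hprod : (0 : ℝ) ≤ ((j : ℕ) - (j' : ℕ) : ℝ) * ((j : ℕ) + 1 - (j' : ℕ)) := by
        rcases Nat.lt_or_ge (j : ℕ) j' with h | h
        · have : ((j : ℕ) : ℝ) + 1 ≤ (j' : ℕ) := by exact_mod_cast h
          exact mul_nonneg_of_nonpos_of_nonpos (by linarith) (by linarith)
        · have : ((j' : ℕ) : ℝ) ≤ (j : ℕ) := by exact_mod_cast h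
          exact mul_nonneg (by linarith) (by linarith)
      by_cases hi : (i : ℕ) = i'
      · obtain rfl := Fin.ext hi
        have h3 : (j : ℕ) ≠ j' := fun h => h1 (by rw [Fin.ext h])
        have h4 : (j : ℕ) + 1 ≠ j' := fun h => h2 (by rw [Fin.ext (hj.trans h)])
        have h5 : ((j : ℕ) - (j' : ℕ) : ℝ) ≠ 0 := sub_ne_zero.2 (by exact_mod_cast h3)
        have h6 : ((j : ℕ) + 1 - (j' : ℕ) : ℝ) ≠ 0 := sub_ne_zero.2 (by exact_mod_cast h4)
        have h7 := lt_of_le_of_ne hprod (mul_ne_zero h5 h6).symm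
        positivity
      · have := one_le_sq_cast_sub hi
        have h3 : 0 < L ^ 2 * ((i : ℕ) - (i' : ℕ) : ℝ) ^ 2 := mul_pos (by positivity) (by linarith)
        linarith

/-- A point on the edge between the faces of the essential vertex `false` and of the last vertex of
a path. -/
theorem thetaEdge_last {K L N : ℝ} (hL : N + 2 ≤ L) (hN0 : 0 ≤ N) (hN : ∀ i, (n i : ℝ) ≤ N)
    (hK : 2 * N + 2 * N ^ 2 + L ^ 2 * k ^ 2 < K)
    (i : Fin k) (j : Fin (n i)) (hj : (j : ℕ) = n i - 1) :
    ∃ p ∈ planeSlice (thetaSlopeX K) (thetaSlopeY L) (thetaHeight (n := n) K L N),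
      p (Sum.inl false) = 0 ∧ p (Sum.inr ⟨i, j⟩) = 0 ∧
      ∀ r, r ≠ Sum.inl false → r ≠ Sum.inr ⟨i, j⟩ → 0 < p r := by
  obtain ⟨m, hm⟩ : ∃ m : ℝ, m = (j : ℕ) := ⟨_, rfl⟩
  have hm0 : 0 ≤ m := by rw [hm]; positivity
  have hmN : m + 1 ≤ N := by
    refine le_trans ?_ (hN i)
    rw [hm]; exact_mod_cast j.2
  have hik : ((i : ℕ) : ℝ) ≤ k := by exact_mod_cast i.2.le
  have hLi : L ^ 2 * ((i : ℕ) : ℝ) ^ 2 ≤ L ^ 2 * k ^ 2 := by gcongr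
  have hLi0 : 0 ≤ L ^ 2 * ((i : ℕ) : ℝ) ^ 2 := by positivity
  have hKm : 0 < K - 2 * m := by nlinarith
  obtain ⟨x, hx⟩ : ∃ x, x = N + (L ^ 2 * ((i : ℕ) : ℝ) ^ 2 - m ^ 2 + 2 * m * N) / (K - 2 * m) :=
    ⟨_, rfl⟩
  have hxN : N ≤ x := by
    rw [hx, le_add_iff_nonneg_right]
    exact div_nonneg (by nlinarith) hKm.le
  have hxN1 : x ≤ N + 1 := by
    rw [hx, add_le_add_iff_left, div_le_one hKm]
    nlinarith
  have hz : K * x - K * N = L ^ 2 * ((i : ℕ) : ℝ) ^ 2 + 2 * m * x - m ^ 2 := by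
    have h : (x - N) * (K - 2 * m) = L ^ 2 * ((i : ℕ) : ℝ) ^ 2 - m ^ 2 + 2 * m * N := by
      rw [hx, add_sub_cancel_left, div_mul_cancel₀ _ hKm.ne']
    linear_combination h
  refine ⟨_, ⟨x, L * (i : ℕ), K * x - K * N, fun s => rfl⟩, ?_, ?_, ?_⟩
  · simp only [thetaSlopeX, thetaSlopeY, thetaHeight]; ring
  · simp only [thetaSlopeX, thetaSlopeY, thetaHeight, ← hm]; rw [hz]; ring
  · rintro ((_ | _) | ⟨i', j'⟩) h1 h2
    · exact absurd rfl h1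
    · simp only [thetaSlopeX, thetaSlopeY, thetaHeight]
      rw [hz]
      nlinarith
    · simp only [thetaSlopeX, thetaSlopeY, thetaHeight]
      have hval : K * x - K * N -
          (2 * ((j' : ℕ) : ℝ) * x +
          2 * L * (i' : ℕ) * (L * (i : ℕ)) + -((j' : ℕ) ^ 2 + L ^ 2 * (i' : ℕ) ^ 2)) =
          L ^ 2 * ((i : ℕ) - (i' : ℕ) : ℝ) ^ 2 +
            (m - (j' : ℕ)) * (2 * x - m - (j' : ℕ)) := by
        rw [hz]; ring
      rw [hval]
      by_cases hi : (i : ℕ) = i'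
      · obtain rfl := Fin.ext hi
        have h3 : (j' : ℕ) ≠ j := fun h => h2 (by rw [Fin.ext h])
        have h4 : ((j' : ℕ) : ℝ) + 1 ≤ m := by
          rw [hm]; exact_mod_cast (by omega : (j' : ℕ) + 1 ≤ j)
        have h5 : 0 < (m - (j' : ℕ)) * (2 * x - m - (j' : ℕ)) :=
          mul_pos (by linarith) (by linarith)
        positivity
      · have h3 := one_le_sq_cast_sub hi
        have h4 : L ^ 2 * 1 ≤ L ^ 2 * ((i : ℕ) - (i' : ℕ) : ℝ) ^ 2 := by gcongr
        have h5 : (m - (j' : ℕ)) * (2 * x - m - (j' : ℕ)) =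
            (x - (j' : ℕ)) ^ 2 - (x - m) ^ 2 := by ring
        have h6 : (x - m) ^ 2 ≤ (N + 1) ^ 2 := by
          apply pow_le_pow_left₀ <;> linarith
        have h7 : (N + 2) ^ 2 ≤ L ^ 2 := by gcongr
        have h8 := sq_nonneg (x - (j' : ℕ))
        nlinarith

theorem thetaEdge_exists {K L N : ℝ} (hL : N + 2 ≤ L) (hN0 : 0 < N) (hN : ∀ i, (n i : ℝ) ≤ N)
    (hK : 2 * N + 2 * N ^ 2 + L ^ 2 * k ^ 2 < K) (s t : ThetaVertex n) (hst : ThetaAdj n s t) :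
    ∃ p ∈ planeSlice (thetaSlopeX K) (thetaSlopeY L) (thetaHeight (n := n) K L N),
      p s = 0 ∧ p t = 0 ∧ ∀ r, r ≠ s → r ≠ t → 0 < p r := by
  have hL0 : 0 < L := by linarith
  have hK0 : 0 < K := lt_of_le_of_lt (by positivity) hK
  have swap : ∀ s t : ThetaVertex n,
      (∃ p ∈ planeSlice (thetaSlopeX K) (thetaSlopeY L) (thetaHeight (n := n) K L N),
        p s = 0 ∧ p t = 0 ∧ ∀ r, r ≠ s → r ≠ t → 0 < p r) →
      ∃ p ∈ planeSlice (thetaSlopeX K) (thetaSlopeY L) (thetaHeight (n := n) K L N),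
        p t = 0 ∧ p s = 0 ∧ ∀ r, r ≠ t → r ≠ s → 0 < p r :=
    fun s t ⟨p, hp, h1, h2, h3⟩ => ⟨p, hp, h2, h1, fun r hr hr' => h3 r hr' hr⟩
  have hess : ∀ (e : Bool) (i : Fin k) (j : Fin (n i)),
      (e = true ∧ (j : ℕ) = 0) ∨ (e = false ∧ (j : ℕ) = n i - 1) →
      ∃ p ∈ planeSlice (thetaSlopeX K) (thetaSlopeY L) (thetaHeight (n := n) K L N),
        p (Sum.inl e) = 0 ∧ p (Sum.inr ⟨i, j⟩) = 0 ∧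
        ∀ r, r ≠ Sum.inl e → r ≠ Sum.inr ⟨i, j⟩ → 0 < p r := by
    rintro e i j (⟨rfl, h⟩ | ⟨rfl, h⟩)
    · exact thetaEdge_first hK0 hL0 hN0 i j h
    · exact thetaEdge_last hL hN0.le hN hK i j h
  rcases s with e | ⟨i, j⟩ <;> rcases t with e' | ⟨i', j'⟩ <;> simp only [ThetaAdj] at hst
  · exact hess e i' j' hst
  · exact swap _ _ (hess e' i j hst)
  · obtain ⟨h1, h2⟩ := hst
    obtain rfl := Fin.ext h1
    rcases h2 with h2 | h2
    · exact thetaEdge_middle hK0 hL0 hN i j j' h2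
    · exact swap _ _ (thetaEdge_middle hK0 hL0 hN i j' j h2)

theorem thetaSlopeX_ne {K : ℝ} (hK : ∀ i, 2 * (n i : ℝ) < K) (s t : ThetaVertex n)
    (hst : ThetaAdj n s t) : thetaSlopeX K s ≠ thetaSlopeX K t := by
  have hess : ∀ (e : Bool) (i : Fin k) (j : Fin (n i)),
      thetaSlopeX (n := n) K (Sum.inl e) ≠ thetaSlopeX K (Sum.inr ⟨i, j⟩) := by
    rintro (_ | _) i j <;> simp only [thetaSlopeX]
    · have h1 := hK i
      have h2 : ((j : ℕ) : ℝ) ≤ n i := by exact_mod_cast j.2.le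
      exact fun h => by linarith
    · have h2 : (0 : ℝ) ≤ (j : ℕ) := by positivity
      exact fun h => by linarith
  rcases s with e | ⟨i, j⟩ <;> rcases t with e' | ⟨i', j'⟩ <;> simp only [ThetaAdj] at hst
  · exact hess e i' j'
  · exact (hess e' i j).symm
  · simp only [thetaSlopeX]
    intro h
    have : (j : ℕ) = j' := by
      have h3 : ((j : ℕ) : ℝ) = (j' : ℕ) := by linarith
      exact_mod_cast h3
    omega

end Theta

/-- **Theorem 5.7 applied to generalized Θ-graphs.** Each right-angled Coxeter group with
generalized Θ-graph nerve acts properly discontinuously by homeomorphisms on a contractible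
3-manifold. -/
theorem thetaRACG_acts_on_contractible_3manifold
    (k : ℕ) (hk : 3 ≤ k) (n : Fin k → ℕ) (hn : ∀ i, 1 ≤ n i) :
    ∃ (M : Type) (_ : TopologicalSpace M),
      IsTopological3Manifold M ∧ ContractibleSpace M ∧
      ∃ _ : MulAction (ThetaRACG n) M,
        (∀ γ : ThetaRACG n, Continuous fun x : M => γ • x) ∧
        ProperlyDiscontinuousSMul (ThetaRACG n) M := by
  obtain ⟨N, hN⟩ : ∃ N : ℝ, ∀ i, (n i : ℝ) ≤ N :=
    ⟨∑ i, (n i : ℝ), fun i => Finset.single_le_sum (f := fun i => (n i : ℝ))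
      (fun _ _ => Nat.cast_nonneg _) (Finset.mem_univ i)⟩
  let i₁ : Fin k := ⟨1, by omega⟩
  let j₀ : Fin (n i₁) := ⟨0, hn i₁⟩
  have hN0 : 0 < N := lt_of_lt_of_le (by exact_mod_cast hn i₁) (hN i₁)
  obtain ⟨L, hL⟩ : ∃ L, L = N + 2 := ⟨_, rfl⟩
  obtain ⟨K, hK⟩ : ∃ K, K = 2 * N + 2 * N ^ 2 + L ^ 2 * k ^ 2 + 1 := ⟨_, rfl⟩
  have hL0 : 0 < L := by linarith
  have hK0 : 2 * N < K := by
    have : 0 ≤ 2 * N ^ 2 + L ^ 2 * (k : ℝ) ^ 2 := by positivity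
    linarith
  have hK2 : K + 2 ≠ 0 := by linarith
  -- the coordinates of a point of `ℝ³` are recovered from its heights above three of the planes
  let X : (ThetaVertex n → ℝ) → ℝ := fun p =>
    (p (Sum.inl true) - p (Sum.inl false) + K * N) / (K + 2)
  let Y : (ThetaVertex n → ℝ) → ℝ := fun p =>
    (p (Sum.inl true) - 2 * X p - p (Sum.inr ⟨i₁, j₀⟩) + L ^ 2) / (2 * L)
  have hX : Continuous X := by fun_prop
  have hY : Continuous Y := by fun_prop
  refine racg_acts_on_contractible_3manifold thetaAdj_irrefl thetaAdj_symm
    (thetaAdj_exists (by omega) hn) thetaAdj_triangle_free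
    (planeSlice_convex (thetaSlopeX K) (thetaSlopeY L) (thetaHeight K L N))
    (fun e he => thetaEdge_exists hL.ge hN0 hN (by linarith) e.1 e.2 he)
    (fun s t hst => planeSlice_chart hX hY ?_
      (thetaSlopeX_ne (fun i => by linarith [hN i]) s t hst))
  intro p x y z hp
  have hXx : X p = x := by
    simp only [X, hp, thetaSlopeX, thetaSlopeY, thetaHeight]
    field_simp
    ring
  refine ⟨hXx, ?_⟩
  simp only [Y, hXx, hp, thetaSlopeX, thetaSlopeY, thetaHeight, i₁, j₀]
  field_simp
  push_cast
  ring
end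

section
/- Let k ≥ 3, let n_1, …, n_k ≥ 1 be integers, and let K ≥ 1 be an integer. Then the right-angled Coxeter group W_{Θ(n_1,…,n_k)} is abstractly commensurable to the right-angled Coxeter group W_{Θ(K(n_1−1)+1, …, K(n_k−1)+1)}. (Equivalently, W with Euler characteristic vector w, where χ_i = (1−n_i)/4, is abstractly commensurable to the group with Euler characteristic vector K·w.) -/
open scoped Classical

/-- Groups `G` and `H` are abstractly commensurable if they have isomorphic finite-index
subgroups. -/
def AbstractlyCommensurable (G H : Type) [Group G] [Group H] : Prop :=
  ∃ (G' : Subgroup G) (H' : Subgroup H),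
    G'.FiniteIndex ∧ H'.FiniteIndex ∧ Nonempty (G' ≃* H')

namespace ThetaRACG

variable {k : ℕ} {m : Fin k → ℕ}

/-- The generator of `W_Θ` at an essential vertex. -/
def ess (m : Fin k → ℕ) (b : Bool) : ThetaRACG (fun i => m i + 1) :=
  PresentedGroup.of (Sum.inl b)

/-- The generator of `W_Θ` at the `r`-th interior vertex of the `i`-th path, for `r ≤ m i`. -/
def inner (m : Fin k → ℕ) (i : Fin k) (r : ℕ) : ThetaRACG (fun i => m i + 1) :=
  PresentedGroup.of (Sum.inr ⟨i, Fin.ofNat (m i + 1) r⟩)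

lemma of_mul_self {V : Type} (adj : V → V → Prop) (v : V) :
    (PresentedGroup.of v : RACG adj) * PresentedGroup.of v = 1 := by
  have h : PresentedGroup.mk (racgRelators adj) (FreeGroup.of v ^ 2) = 1 :=
    PresentedGroup.one_of_mem (Or.inl ⟨v, rfl⟩)
  rw [map_pow, sq] at h
  exact h

lemma commute_of_mul_self {G : Type*} [Group G] {x y : G} (hx : x * x = 1) (hy : y * y = 1)
    (hxy : (x * y) ^ 2 = 1) : Commute x y := by
  have h : x * y = (x * y)⁻¹ := eq_inv_of_mul_eq_one_left (by rwa [← sq])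
  rw [mul_inv_rev, ← eq_inv_of_mul_eq_one_left hx, ← eq_inv_of_mul_eq_one_left hy] at h
  exact h

lemma commute_of_adj {V : Type} (adj : V → V → Prop) {u v : V} (h : adj u v) :
    Commute (PresentedGroup.of u : RACG adj) (PresentedGroup.of v) := by
  refine commute_of_mul_self (of_mul_self adj u) (of_mul_self adj v) ?_
  have h : PresentedGroup.mk (racgRelators adj) ((FreeGroup.of u * FreeGroup.of v) ^ 2) = 1 :=
    PresentedGroup.one_of_mem (Or.inr ⟨u, v, h, rfl⟩)
  rw [map_pow, map_mul] at h
  exact h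

lemma ess_mul_self (b : Bool) : ess m b * ess m b = 1 := of_mul_self _ _

lemma inner_mul_self (i : Fin k) (r : ℕ) : inner m i r * inner m i r = 1 := of_mul_self _ _

lemma inner_commute_succ (i : Fin k) {r : ℕ} (hr : r < m i) :
    Commute (inner m i r) (inner m i (r + 1)) := by
  refine commute_of_adj _ ⟨rfl, Or.inl ?_⟩
  simp only [Fin.val_ofNat]
  rw [Nat.mod_eq_of_lt (by omega), Nat.mod_eq_of_lt (by omega)]

lemma inner_zero_commute (i : Fin k) : Commute (inner m i 0) (ess m true) :=
  commute_of_adj _ (Or.inl ⟨rfl, by simp⟩)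

lemma inner_last_commute (i : Fin k) : Commute (inner m i (m i)) (ess m false) :=
  commute_of_adj _ (Or.inr ⟨rfl, by simp⟩)

/-- Induction over the generators of `W_Θ`. -/
lemma induction_on {P : ThetaRACG (fun i => m i + 1) → Prop} (hone : P 1)
    (hmul : ∀ x y, P x → P y → P (x * y)) (hinv : ∀ x, P x → P x⁻¹)
    (hess : ∀ b, P (ess m b)) (hinner : ∀ i r, r ≤ m i → P (inner m i r))
    (w : ThetaRACG (fun i => m i + 1)) : P w := by
  have hw : w ∈ Subgroup.closure (Set.range (PresentedGroup.of (rels := racgRelators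
      (ThetaAdj (fun i => m i + 1))))) := by
    rw [PresentedGroup.closure_range_of]; trivial
  induction hw using Subgroup.closure_induction with
  | mem x hx =>
    obtain ⟨b | ⟨i, r⟩, rfl⟩ := hx
    · exact hess b
    · have := hinner i r (Nat.lt_succ_iff.mp r.2)
      rwa [inner, show Fin.ofNat (m i + 1) (r : ℕ) = r from
        Fin.ext (Nat.mod_eq_of_lt r.2)] at this
  | one => exact hone
  | mul x y _ _ hx hy => exact hmul x y hx hy
  | inv x _ hx => exact hinv x hx

/-- The images of the generators under a homomorphism out of `W_Θ`. -/
def genImage {G : Type*} (e : Bool → G) (v : Fin k → ℕ → G) :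
    ThetaVertex (fun i => m i + 1) → G
  | Sum.inl b => e b
  | Sum.inr ⟨i, r⟩ => v i r

/-- A family of involutions satisfying the commutation relations of `W_Θ`. -/
structure IsThetaFamily {G : Type*} [Group G] (m : Fin k → ℕ) (e : Bool → G)
    (v : Fin k → ℕ → G) : Prop where
  ess_mul_self : ∀ b, e b * e b = 1
  inner_mul_self : ∀ i r, r ≤ m i → v i r * v i r = 1
  inner_commute_succ : ∀ i r, r < m i → Commute (v i r) (v i (r + 1))
  inner_zero_commute : ∀ i, Commute (v i 0) (e true)
  inner_last_commute : ∀ i, Commute (v i (m i)) (e false)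

section lift

variable {G : Type*} [Group G] {e : Bool → G} {v : Fin k → ℕ → G}

lemma IsThetaFamily.genImage_mul_self (h : IsThetaFamily m e v)
    (x : ThetaVertex (fun i => m i + 1)) : genImage e v x * genImage e v x = 1 := by
  rcases x with b | ⟨i, r⟩
  · exact h.ess_mul_self b
  · exact h.inner_mul_self i r (Nat.lt_succ_iff.mp r.2)

lemma IsThetaFamily.genImage_commute (h : IsThetaFamily m e v)
    {x y : ThetaVertex (fun i => m i + 1)} (hxy : ThetaAdj _ x y) :
    Commute (genImage e v x) (genImage e v y) := by
  have key : ∀ b i r, ((b = true ∧ r = 0) ∨ (b = false ∧ r = m i + 1 - 1)) →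
      Commute (v i r) (e b) := by
    rintro b i r (⟨rfl, rfl⟩ | ⟨rfl, rfl⟩)
    · exact h.inner_zero_commute i
    · exact h.inner_last_commute i
  rcases x with b | ⟨i, r, hr⟩ <;> rcases y with b' | ⟨i', r', hr'⟩
  · exact hxy.elim
  · exact (key _ _ _ hxy).symm
  · exact key _ _ _ hxy
  · obtain ⟨hi, hxy⟩ := hxy
    obtain rfl := Fin.ext hi
    simp only at hxy hr hr'
    rcases hxy with rfl | rfl
    · exact h.inner_commute_succ i _ (Nat.lt_of_succ_lt_succ ‹_›)
    · exact (h.inner_commute_succ i _ (Nat.lt_of_succ_lt_succ ‹_›)).symm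

/-- The homomorphism out of `W_Θ` given by the images of the generators. -/
def lift (h : IsThetaFamily m e v) : ThetaRACG (fun i => m i + 1) →* G :=
  PresentedGroup.toGroup (f := genImage e v) (by
    rintro w (⟨x, rfl⟩ | ⟨x, y, hxy, rfl⟩)
    · rw [map_pow, FreeGroup.lift_apply_of, sq, h.genImage_mul_self]
    · rw [map_pow, map_mul, FreeGroup.lift_apply_of, FreeGroup.lift_apply_of,
        (h.genImage_commute hxy).mul_pow, sq, sq, h.genImage_mul_self, h.genImage_mul_self,
        one_mul])

lemma lift_ess (h : IsThetaFamily m e v) (b : Bool) : lift h (ess m b) = e b :=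
  PresentedGroup.toGroup.of _

lemma lift_inner (h : IsThetaFamily m e v) {i : Fin k} {r : ℕ} (hr : r ≤ m i) :
    lift h (inner m i r) = v i r := by
  refine (PresentedGroup.toGroup.of _).trans ?_
  change v i (r % (m i + 1)) = v i r
  rw [Nat.mod_eq_of_lt (by omega)]

end lift

/-- The position, counted from the left, of the `q`-th side of a block of length `M` in its
`j`-th copy; odd copies are mirrored. -/
def mirror (M j q : ℕ) : ℕ := if j.bodd then M - q else q

lemma mirror_le {M q : ℕ} (j : ℕ) (hq : q ≤ M) : mirror M j q ≤ M := by
  unfold mirror; split_ifs <;> omega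

lemma mirror_mirror {M q : ℕ} (j : ℕ) (hq : q ≤ M) : mirror M j (mirror M j q) = q := by
  unfold mirror; split_ifs <;> omega

lemma inner_mirror_commute_succ (i : Fin k) (j : ℕ) {q : ℕ} (hq : q < m i) :
    Commute (inner m i (mirror (m i) j q)) (inner m i (mirror (m i) j (q + 1))) := by
  unfold mirror
  split_ifs
  · have := inner_commute_succ (m := m) i (r := m i - (q + 1)) (by omega)
    rw [show m i - (q + 1) + 1 = m i - q by omega] at this
    exact this.symm
  · exact inner_commute_succ i hq

lemma inner_mirror_commute_ess (i : Fin k) (j : ℕ) :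
    Commute (inner m i (mirror (m i) j (m i))) (ess m j.bodd) := by
  unfold mirror
  split_ifs with h
  · rw [h, Nat.sub_self]; exact inner_zero_commute i
  · rw [Bool.not_eq_true] at h
    rw [h]; exact inner_last_commute i

/-- The element of the infinite dihedral group generated by the essential vertices that moves
the base chamber to its `j`-th successor. -/
def shift (m : Fin k → ℕ) : ℕ → ThetaRACG (fun i => m i + 1)
  | 0 => 1
  | j + 1 => shift m j * ess m j.bodd

/-- The image in `W_Θ` of the `p`-th interior vertex of the `i`-th path of the unfolded graph. -/
def unfoldInner (m : Fin k → ℕ) (i : Fin k) (p : ℕ) : ThetaRACG (fun i => m i + 1) :=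
  MulAut.conj (shift m (p / m i)) (inner m i (mirror (m i) (p / m i) (p % m i)))

/-- The image in `W_Θ` of the essential vertices of the unfolded graph. -/
def unfoldEss (m : Fin k → ℕ) (L : ℕ) : Bool → ThetaRACG (fun i => m i + 1)
  | true => ess m true
  | false => MulAut.conj (shift m L) (ess m L.bodd)

lemma shift_commute_inner {i : Fin k} (hi : m i = 0) (j : ℕ) :
    Commute (shift m j) (inner m i 0) := by
  induction j with
  | zero => exact Commute.one_left _
  | succ j ih =>
    refine ih.mul_left ?_
    have := inner_mirror_commute_ess (m := m) i j
    rw [show mirror (m i) j (m i) = 0 by simp [mirror, hi]] at this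
    exact this.symm

lemma conj_eq_of_commute {G : Type*} [Group G] {x y : G} (h : Commute x y) :
    MulAut.conj x y = y := by
  rw [MulAut.conj_apply, h.eq, mul_inv_cancel_right]

lemma unfoldInner_add (i : Fin k) (j : ℕ) {q : ℕ} (hq : q ≤ m i) :
    unfoldInner m i (j * m i + q) =
      MulAut.conj (shift m j) (inner m i (mirror (m i) j q)) := by
  rcases Nat.eq_zero_or_pos (m i) with h0 | hpos
  · obtain rfl : q = 0 := by omega
    have hm : ∀ j, mirror (m i) j 0 = 0 := by simp [mirror, h0]
    simp only [unfoldInner, h0, Nat.mul_zero, Nat.add_zero, Nat.zero_div, Nat.zero_mod]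
    rw [h0] at hm
    rw [hm, hm, conj_eq_of_commute (shift_commute_inner h0 _),
      conj_eq_of_commute (shift_commute_inner h0 _)]
  · rcases hq.lt_or_eq with hq | rfl
    · have h1 : (j * m i + q) / m i = j := by
        rw [mul_comm, Nat.mul_add_div hpos, Nat.div_eq_of_lt hq, add_zero]
      have h2 : (j * m i + q) % m i = q := by
        rw [mul_comm, Nat.mul_add_mod, Nat.mod_eq_of_lt hq]
      rw [unfoldInner, h1, h2]
    · have h1 : (j * m i + m i) / m i = j + 1 := by
        rw [← Nat.succ_mul, Nat.mul_div_cancel _ hpos]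
      have h2 : (j * m i + m i) % m i = 0 := by
        rw [← Nat.succ_mul, Nat.mul_mod_left]
      have h3 : mirror (m i) (j + 1) 0 = mirror (m i) j (m i) := by
        simp only [mirror, Nat.bodd_succ]
        cases j.bodd <;> simp
      rw [unfoldInner, h1, h2, h3, shift, map_mul, MulAut.mul_apply,
        conj_eq_of_commute (inner_mirror_commute_ess i j).symm]

lemma unfold_isThetaFamily (m : Fin k → ℕ) (L : ℕ) :
    IsThetaFamily (fun i => (L + 1) * m i) (unfoldEss m L) (unfoldInner m) where
  ess_mul_self b := by
    cases b
    · rw [unfoldEss, ← map_mul, ess_mul_self, map_one]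
    · exact ess_mul_self _
  inner_mul_self i r _ := by rw [unfoldInner, ← map_mul, inner_mul_self, map_one]
  inner_commute_succ i r hr := by
    have hpos : 0 < m i := Nat.pos_of_ne_zero (by rintro h; simp [h] at hr)
    have hq := Nat.mod_lt r hpos
    have hr' : r = r / m i * m i + r % m i := by rw [mul_comm, Nat.div_add_mod]
    rw [hr', add_assoc, unfoldInner_add i _ hq.le, unfoldInner_add i _ hq]
    exact (inner_mirror_commute_succ i _ hq).map _
  inner_zero_commute i := by
    have h : unfoldInner m i 0 = inner m i 0 := by
      simpa [shift, mirror] using unfoldInner_add (m := m) i 0 (Nat.zero_le _)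
    rw [h]
    exact inner_zero_commute i
  inner_last_commute i := by
    rw [Nat.succ_mul, unfoldInner_add i L le_rfl]
    exact (inner_mirror_commute_ess i L).map _

/-- The homomorphism from the group of the unfolded graph to `W_Θ`. -/
def unfold (m : Fin k → ℕ) (L : ℕ) :
    ThetaRACG (fun i => (L + 1) * m i + 1) →* ThetaRACG (fun i => m i + 1) :=
  lift (unfold_isThetaFamily m L)

/-- The chambers of the induced action: `L + 1` copies of the group of the unfolded graph. -/
abbrev Chamber (m : Fin k → ℕ) (L : ℕ) : Type :=
  ThetaRACG (fun i => (L + 1) * m i + 1) × Fin (L + 1)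

/-- The action of an essential vertex on chambers: it crosses the right or the left wall of a
copy according to parity. -/
def essAct (m : Fin k → ℕ) (L : ℕ) (b : Bool) (x : Chamber m L) : Chamber m L :=
  if b = (x.2 : ℕ).bodd then
    if h : (x.2 : ℕ) + 1 < L + 1 then (x.1, ⟨x.2 + 1, h⟩) else (ess _ false * x.1, x.2)
  else if (x.2 : ℕ) = 0 then (ess _ true * x.1, x.2)
  else (x.1, ⟨x.2 - 1, by omega⟩)

/-- The action of an interior vertex on chambers. -/
def innerAct (m : Fin k → ℕ) (L : ℕ) (i : Fin k) (r : ℕ) (x : Chamber m L) : Chamber m L :=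
  (inner _ i (x.2 * m i + mirror (m i) x.2 r) * x.1, x.2)

variable {L : ℕ}

lemma essAct_right {j : ℕ} (hj : j + 1 < L + 1) (g : ThetaRACG (fun i => (L + 1) * m i + 1)) :
    essAct m L j.bodd (g, ⟨j, by omega⟩) = (g, ⟨j + 1, hj⟩) := by
  simp [essAct, Nat.lt_of_succ_lt_succ hj]

lemma essAct_left {j : ℕ} (hj : j + 1 < L + 1) (g : ThetaRACG (fun i => (L + 1) * m i + 1)) :
    essAct m L j.bodd (g, ⟨j + 1, hj⟩) = (g, ⟨j, by omega⟩) := by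
  simp [essAct]

lemma essAct_last (g : ThetaRACG (fun i => (L + 1) * m i + 1)) :
    essAct m L L.bodd (g, ⟨L, by omega⟩) = (ess _ false * g, ⟨L, by omega⟩) := by
  simp [essAct]

lemma essAct_first (g : ThetaRACG (fun i => (L + 1) * m i + 1)) :
    essAct m L true (g, ⟨0, by omega⟩) = (ess _ true * g, ⟨0, by omega⟩) := by
  simp [essAct]

/-- Case distinction on how an essential vertex meets a copy: crossing to the right, crossing
to the left, the last wall, or the first wall. -/
lemma wall_cases {P : Bool → Fin (L + 1) → Prop}
    (hright : ∀ j (hj : j + 1 < L + 1), P j.bodd ⟨j, by omega⟩)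
    (hleft : ∀ j (hj : j + 1 < L + 1), P j.bodd ⟨j + 1, hj⟩)
    (hlast : P L.bodd ⟨L, by omega⟩) (hfirst : P true ⟨0, by omega⟩) (b : Bool)
    (j : Fin (L + 1)) : P b j := by
  obtain ⟨j, hj⟩ := j
  by_cases hb : b = j.bodd
  · subst hb
    by_cases h : j + 1 < L + 1
    · exact hright j h
    · obtain rfl : j = L := by omega
      exact hlast
  · cases j with
    | zero =>
      obtain rfl : b = true := by simpa using hb
      exact hfirst
    | succ j =>
      obtain rfl : b = j.bodd := by
        rw [Nat.bodd_succ] at hb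
        cases b <;> cases h : j.bodd <;> simp_all
      exact hleft j hj

lemma essAct_involutive (b : Bool) : Function.Involutive (essAct m L b) := by
  rintro ⟨g, j⟩
  induction b, j using wall_cases with
  | hright j hj => rw [essAct_right hj, essAct_left hj]
  | hleft j hj => rw [essAct_left hj, essAct_right hj]
  | hlast => rw [essAct_last, essAct_last, ← mul_assoc, ess_mul_self, one_mul]
  | hfirst => rw [essAct_first, essAct_first, ← mul_assoc, ess_mul_self, one_mul]

lemma innerAct_involutive (i : Fin k) (r : ℕ) : Function.Involutive (innerAct m L i r) := by
  rintro ⟨g, j⟩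
  simp only [innerAct]
  rw [← mul_assoc, inner_mul_self, one_mul]

lemma mirror_wall_succ (M j : ℕ) :
    (j + 1) * M + mirror M (j + 1) (if j.bodd then 0 else M) =
      j * M + mirror M j (if j.bodd then 0 else M) := by
  simp only [mirror, Nat.bodd_succ]
  cases j.bodd <;> simp [Nat.succ_mul]

/-- An essential vertex and the neighbouring interior vertex act by commuting maps. -/
lemma innerAct_essAct (i : Fin k) (b : Bool) (x : Chamber m L) :
    innerAct m L i (if b then 0 else m i) (essAct m L b x) =
      essAct m L b (innerAct m L i (if b then 0 else m i) x) := by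
  obtain ⟨g, j⟩ := x
  induction b, j using wall_cases with
  | hright j hj =>
    rw [essAct_right hj]; unfold innerAct; rw [essAct_right hj]
    simp only [mirror_wall_succ]
  | hleft j hj =>
    rw [essAct_left hj]; unfold innerAct; rw [essAct_left hj]
    simp only [mirror_wall_succ]
  | hlast =>
    rw [essAct_last]; unfold innerAct; rw [essAct_last]
    have h : L * m i + mirror (m i) L (if L.bodd then 0 else m i) = (L + 1) * m i := by
      unfold mirror; cases L.bodd <;> simp [Nat.succ_mul]
    simp only [h, ← mul_assoc]
    rw [(inner_last_commute (m := fun i => (L + 1) * m i) i).eq]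
  | hfirst =>
    rw [essAct_first]; unfold innerAct; rw [essAct_first]
    have h : 0 * m i + mirror (m i) 0 0 = 0 := by simp [mirror]
    simp only [if_true, h, ← mul_assoc]
    rw [(inner_zero_commute (m := fun i => (L + 1) * m i) i).eq]

lemma block_le (M : ℕ) {j q : ℕ} (hj : j < L + 1) (hq : q ≤ M) :
    j * M + q ≤ (L + 1) * M := by
  have := Nat.mul_le_mul_right M (Nat.succ_le_of_lt hj)
  rw [Nat.succ_mul] at this
  omega

lemma inner_block_commute (i : Fin k) {j r : ℕ} (hj : j < L + 1) (hr : r < m i) :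
    Commute (inner (fun i => (L + 1) * m i) i (j * m i + mirror (m i) j r))
      (inner (fun i => (L + 1) * m i) i (j * m i + mirror (m i) j (r + 1))) := by
  unfold mirror
  split_ifs
  · have hb := block_le (m i) hj (q := m i - (r + 1) + 1) (by omega)
    have := inner_commute_succ (m := fun i => (L + 1) * m i) i
      (r := j * m i + (m i - (r + 1))) (by omega)
    rw [add_assoc, show m i - (r + 1) + 1 = m i - r by omega] at this
    exact this.symm
  · have hb := block_le (m i) hj (q := r + 1) (by omega)
    exact inner_commute_succ (m := fun i => (L + 1) * m i) i (by omega)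

lemma act_isThetaFamily (m : Fin k → ℕ) (L : ℕ) :
    IsThetaFamily m (fun b => (essAct_involutive (m := m) (L := L) b).toPerm)
      (fun i r => (innerAct_involutive (m := m) (L := L) i r).toPerm) where
  ess_mul_self b := Equiv.ext (essAct_involutive b)
  inner_mul_self i r _ := Equiv.ext (innerAct_involutive i r)
  inner_commute_succ i r hr := Equiv.ext fun ⟨g, j⟩ => by
    change innerAct m L i r (innerAct m L i (r + 1) (g, j)) =
      innerAct m L i (r + 1) (innerAct m L i r (g, j))
    simp only [innerAct, ← mul_assoc]
    rw [(inner_block_commute i j.2 hr).eq]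
  inner_zero_commute i := Equiv.ext (innerAct_essAct i true)
  inner_last_commute i := Equiv.ext (innerAct_essAct i false)

/-- The action of `W_Θ` on chambers. -/
def act (m : Fin k → ℕ) (L : ℕ) :
    ThetaRACG (fun i => m i + 1) →* Equiv.Perm (Chamber m L) :=
  lift (act_isThetaFamily m L)

lemma act_ess (b : Bool) (x : Chamber m L) : act m L (ess m b) x = essAct m L b x := by
  rw [act, lift_ess]; rfl

lemma act_inner {i : Fin k} {r : ℕ} (hr : r ≤ m i) (x : Chamber m L) :
    act m L (inner m i r) x = innerAct m L i r x := by
  rw [act, lift_inner _ hr]; rfl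

lemma act_shift {j : ℕ} (hj : j < L + 1) (g : ThetaRACG (fun i => (L + 1) * m i + 1)) :
    act m L (shift m j) (g, ⟨j, hj⟩) = (g, ⟨0, by omega⟩) := by
  induction j with
  | zero => simp [shift]
  | succ j ih => rw [shift, map_mul, Equiv.Perm.mul_apply, act_ess, essAct_left hj, ih]

lemma act_conj_shift {j : ℕ} (hj : j < L + 1) {w : ThetaRACG (fun i => m i + 1)}
    {g h : ThetaRACG (fun i => (L + 1) * m i + 1)}
    (hw : act m L w (g, ⟨j, hj⟩) = (h, ⟨j, hj⟩)) :
    act m L (MulAut.conj (shift m j) w) (g, ⟨0, by omega⟩) = (h, ⟨0, by omega⟩) := by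
  rw [← act_shift hj g, ← Equiv.Perm.mul_apply, ← map_mul, MulAut.conj_apply,
    inv_mul_cancel_right, map_mul, Equiv.Perm.mul_apply, hw, act_shift]

/-- Every position on an unfolded path lies in one of the `L + 1` blocks. -/
lemma exists_block {M p : ℕ} (hp : p ≤ (L + 1) * M) :
    ∃ j q, j < L + 1 ∧ q ≤ M ∧ p = j * M + q := by
  rcases hp.lt_or_eq with h | rfl
  · have hM : 0 < M := Nat.pos_of_ne_zero (by rintro rfl; simp at h)
    exact ⟨p / M, p % M, Nat.div_lt_of_lt_mul (by rwa [mul_comm]), (Nat.mod_lt _ hM).le,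
      by rw [mul_comm, Nat.div_add_mod]⟩
  · exact ⟨L, M, by omega, le_rfl, Nat.succ_mul L M⟩

/-- The unfolded group acts on the base copy by left multiplication. -/
lemma act_unfold (w g : ThetaRACG (fun i => (L + 1) * m i + 1)) :
    act m L (unfold m L w) (g, ⟨0, by omega⟩) = (w * g, ⟨0, by omega⟩) := by
  induction w using induction_on (m := fun i => (L + 1) * m i) generalizing g with
  | hone => simp
  | hmul x y hx hy => rw [map_mul, map_mul, Equiv.Perm.mul_apply, hy, hx, mul_assoc]
  | hinv x hx => rw [map_inv, map_inv, Equiv.Perm.inv_eq_iff_eq, hx, mul_inv_cancel_left]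
  | hess b =>
    rw [unfold, lift_ess]
    cases b
    · exact act_conj_shift (Nat.lt_succ_self L) (by rw [act_ess, essAct_last])
    · rw [unfoldEss, act_ess, essAct_first]
  | hinner i p hp =>
    rw [unfold, lift_inner _ hp]
    obtain ⟨j, q, hj, hq, rfl⟩ := exists_block hp
    rw [unfoldInner_add i j hq]
    refine act_conj_shift hj ?_
    rw [act_inner (mirror_le j hq), innerAct, mirror_mirror j hq]

lemma unfold_injective (m : Fin k → ℕ) (L : ℕ) : Function.Injective (unfold m L) := by
  rw [injective_iff_map_eq_one]
  intro w hw
  have h := act_unfold w 1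
  rw [hw, map_one, mul_one] at h
  exact (congrArg Prod.fst h).symm

/-- The element of `W_Θ` represented by a chamber. -/
def chamberElt (m : Fin k → ℕ) (L : ℕ) (x : Chamber m L) : ThetaRACG (fun i => m i + 1) :=
  (shift m x.2)⁻¹ * unfold m L x.1

lemma ess_inv (b : Bool) : (ess m b)⁻¹ = ess m b :=
  inv_eq_of_mul_eq_one_right (ess_mul_self b)

lemma chamberElt_essAct (b : Bool) (x : Chamber m L) :
    chamberElt m L (essAct m L b x) = ess m b * chamberElt m L x := by
  obtain ⟨g, j⟩ := x
  induction b, j using wall_cases with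
  | hright j hj => rw [essAct_right hj]; simp [chamberElt, shift, ess_inv, mul_assoc]
  | hleft j hj =>
    rw [essAct_left hj]
    simp only [chamberElt, shift, mul_inv_rev, ess_inv, ← mul_assoc, ess_mul_self, one_mul]
  | hlast =>
    rw [essAct_last]
    simp only [chamberElt, map_mul, unfold, lift_ess, unfoldEss, MulAut.conj_apply]
    group
  | hfirst =>
    rw [essAct_first]
    simp [chamberElt, map_mul, unfold, lift_ess, unfoldEss, shift]

lemma chamberElt_innerAct {i : Fin k} {r : ℕ} (hr : r ≤ m i) (x : Chamber m L) :
    chamberElt m L (innerAct m L i r x) = inner m i r * chamberElt m L x := by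
  obtain ⟨g, j, hj⟩ := x
  have hq := mirror_le j hr
  simp only [chamberElt, innerAct, map_mul, unfold]
  rw [lift_inner _ (block_le _ hj hq), unfoldInner_add i j hq, mirror_mirror j hr,
    MulAut.conj_apply]
  group

lemma chamberElt_act (w : ThetaRACG (fun i => m i + 1)) (x : Chamber m L) :
    chamberElt m L (act m L w x) = w * chamberElt m L x := by
  induction w using induction_on generalizing x with
  | hone => simp
  | hmul u v hu hv => rw [map_mul, Equiv.Perm.mul_apply, hu, hv, mul_assoc]
  | hinv u hu =>
    rw [eq_inv_mul_iff_mul_eq, ← hu, ← Equiv.Perm.mul_apply, ← map_mul, mul_inv_cancel, map_one,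
      Equiv.Perm.one_apply]
  | hess b => rw [act_ess, chamberElt_essAct]
  | hinner i r hr => rw [act_inner hr, chamberElt_innerAct hr]

lemma unfold_range_finiteIndex (m : Fin k → ℕ) (L : ℕ) : (unfold m L).range.FiniteIndex := by
  have hsurj : Function.Surjective (fun j : Fin (L + 1) =>
      (QuotientGroup.mk (shift m j)⁻¹ :
        ThetaRACG (fun i => m i + 1) ⧸ (unfold m L).range)) := by
    intro y
    induction y using QuotientGroup.induction_on with
    | H w =>
      have h := chamberElt_act (L := L) w (1, ⟨0, by omega⟩)
      rw [show chamberElt m L (1, ⟨0, by omega⟩) = 1 by simp [chamberElt, shift], mul_one] at h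
      refine ⟨(act m L w (1, ⟨0, by omega⟩)).2, QuotientGroup.eq.mpr ?_⟩
      exact ⟨_, eq_inv_mul_iff_mul_eq.mpr h⟩
  have := Finite.of_surjective _ hsurj
  exact Subgroup.finiteIndex_of_finite_quotient

end ThetaRACG

/-- **Lemma 4.6.** The right-angled Coxeter group with Euler characteristic vector `w`
(where `χᵢ = (1 − nᵢ)/4`) is abstractly commensurable to the one with Euler characteristic
vector `K·w`, i.e. `W_{Θ(n₁,…,n_k)}` is abstractly commensurable to
`W_{Θ(K(n₁−1)+1,…,K(n_k−1)+1)}`. -/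
theorem thetaRACG_commensurable_scaled
    (k : ℕ) (hk : 3 ≤ k) (n : Fin k → ℕ) (hn : ∀ i, 1 ≤ n i) (K : ℕ) (hK : 1 ≤ K) :
    AbstractlyCommensurable (ThetaRACG n) (ThetaRACG fun i => K * (n i - 1) + 1) := by
  obtain ⟨m, rfl⟩ : ∃ m : Fin k → ℕ, n = fun i => m i + 1 :=
    ⟨fun i => n i - 1, funext fun i => (Nat.sub_add_cancel (hn i)).symm⟩
  obtain ⟨L, rfl⟩ : ∃ L, K = L + 1 := ⟨K - 1, (Nat.sub_add_cancel hK).symm⟩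
  exact ⟨(ThetaRACG.unfold m L).range, ⊤, ThetaRACG.unfold_range_finiteIndex m L, inferInstance,
    ⟨(MonoidHom.ofInjective (ThetaRACG.unfold_injective m L)).symm.trans
      Subgroup.topEquiv.symm⟩⟩
end

section
/- Let ℓ ≥ 2 and h ≥ 0 be integers with ℓ + h ≥ 3, let n_{ℓ+1}, …, n_{ℓ+h} ≥ 2 be integers, and let m ≥ 1 be an integer. Let Θ be the generalized Θ-graph with ℓ paths of parameter 1 and paths of parameters n_{ℓ+1}, …, n_{ℓ+h}. Then the right-angled Coxeter group W_Θ is abstractly commensurable to W_{Θ'}, where Θ' is the generalized Θ-graph with m(ℓ−2)+2 paths of parameter 1 and, for each j with ℓ+1 ≤ j ≤ ℓ+h, exactly m paths of parameter n_j. -/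
open scoped Classical

namespace RACG

variable {V V' : Type} {adj : V → V → Prop} {adj' : V' → V' → Prop}

theorem of_mul_self (v : V) :
    (PresentedGroup.of v : RACG adj) * PresentedGroup.of v = 1 := by
  have h : PresentedGroup.mk (racgRelators adj) (FreeGroup.of v ^ 2) = 1 :=
    PresentedGroup.one_of_mem (Or.inl ⟨v, rfl⟩)
  rwa [map_pow, pow_two] at h

theorem of_inv (v : V) :
    (PresentedGroup.of v : RACG adj)⁻¹ = PresentedGroup.of v :=
  inv_eq_of_mul_eq_one_left (of_mul_self v)

theorem commute_of {u v : V} (h : adj u v) :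
    Commute (PresentedGroup.of u : RACG adj) (PresentedGroup.of v) := by
  have h2 : PresentedGroup.mk (racgRelators adj) ((FreeGroup.of u * FreeGroup.of v) ^ 2) = 1 :=
    PresentedGroup.one_of_mem (Or.inr ⟨u, v, h, rfl⟩)
  rw [map_pow, pow_two, map_mul] at h2
  have h3 := eq_inv_of_mul_eq_one_left h2
  rw [mul_inv_rev] at h3
  exact h3.trans (congrArg₂ _ (of_inv v) (of_inv u))

/-- The homomorphism out of a right-angled Coxeter group determined by involutions that commute
along edges. -/
noncomputable def lift {G : Type*} [Group G] (φ : V → G) (hsq : ∀ v, φ v * φ v = 1)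
    (hcomm : ∀ u v, adj u v → Commute (φ u) (φ v)) : RACG adj →* G :=
  PresentedGroup.toGroup (f := φ) (by
    rintro _ (⟨v, rfl⟩ | ⟨u, v, h, rfl⟩)
    · simp [pow_two, hsq]
    · simp only [map_pow, map_mul, FreeGroup.lift_apply_of]
      rw [(hcomm u v h).mul_pow, pow_two, pow_two, hsq, hsq, one_mul])

@[simp]
theorem lift_of {G : Type*} [Group G] (φ : V → G) (hsq : ∀ v, φ v * φ v = 1)
    (hcomm : ∀ u v, adj u v → Commute (φ u) (φ v)) (v : V) :
    lift φ hsq hcomm (PresentedGroup.of v) = φ v :=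
  PresentedGroup.toGroup.of _

/-- Left multiplication by generators suffices for induction, since generators are involutions. -/
theorem induction_left {P : RACG adj → Prop} (one : P 1)
    (mul : ∀ v w, P w → P (PresentedGroup.of v * w)) (w : RACG adj) : P w := by
  have hw : w ∈ Subgroup.closure (Set.range (PresentedGroup.of (rels := racgRelators adj))) := by
    rw [PresentedGroup.closure_range_of]; trivial
  induction hw using Subgroup.closure_induction_left with
  | one => exact one
  | mul_left x hx y _ ih =>
    obtain ⟨v, rfl⟩ := hx
    exact mul v y ih
  | inv_mul_cancel x hx y _ ih =>
    obtain ⟨v, rfl⟩ := hx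
    rw [of_inv]
    exact mul v y ih

/-- The data exhibiting `adj'` as the graph obtained from `adj` by unfolding it `m` times along the
infinite dihedral group generated by two vertices `c false`, `c true`. The vertices adjacent to
both are kept, the vertices `c` are replaced by the two end walls `e₀`, `e₁`, and every other
vertex has one copy `copy i v` for each `i < m`. -/
structure DihedralUnfolding (adj : V → V → Prop) (adj' : V' → V' → Prop) (m : ℕ) where
  c : Bool → V
  e₀ : V'
  e₁ : V'
  copy : ℕ → V → V'
  proj : V' → V
  idx : V' → ℕ
  pos : 0 < m
  c_injective : Function.Injective c
  adj_symm : ∀ u v, adj u v → adj v u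
  adj_copy : ∀ i u v, adj u v → u ∉ Set.range c → v ∉ Set.range c → adj' (copy i u) (copy i v)
  notMem_of_adj : ∀ t v, adj (c t) v → v ∉ Set.range c
  adj_of_adj : ∀ t v, adj (c t) v → ∀ s, adj (c s) v
  copy_eq : ∀ t v, adj (c t) v → ∀ i j, copy i v = copy j v
  adj_e₀ : ∀ t v, adj (c t) v → ∀ i, adj' e₀ (copy i v)
  adj_e₁ : ∀ t v, adj (c t) v → ∀ i, adj' e₁ (copy i v)
  adj_proj : ∀ u v, adj' u v → adj (proj u) (proj v) ∧
    (idx u = idx v ∨ adj (c true) (proj u) ∨ adj (c true) (proj v))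
  proj_e₀ : proj e₀ = c true
  proj_e₁ : proj e₁ = c (m - 1).bodd
  idx_e₀ : idx e₀ = 0
  idx_e₁ : idx e₁ = m - 1
  proj_notMem : ∀ v, v ≠ e₀ → v ≠ e₁ → proj v ∉ Set.range c
  idx_lt : ∀ v, idx v < m
  copy_idx_proj : ∀ v, v ≠ e₀ → v ≠ e₁ → copy (idx v) (proj v) = v
  proj_copy : ∀ i v, v ∉ Set.range c → proj (copy i v) = v
  idx_copy : ∀ i v, v ∉ Set.range c → i < m → idx (copy i v) = i ∨ adj (c true) v

namespace DihedralUnfolding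

variable {m : ℕ} (D : DihedralUnfolding adj adj' m)

/-- The alternating product of length `i` in the two dihedral generators. -/
noncomputable def word : ℕ → RACG adj
  | 0 => 1
  | i + 1 => PresentedGroup.of (D.c i.bodd) * word i

theorem commute_word {v : V} (h : adj (D.c true) v) (i : ℕ) :
    Commute (D.word i) (PresentedGroup.of v) := by
  induction i with
  | zero => exact Commute.one_left _
  | succ i ih => exact (commute_of (D.adj_of_adj _ _ h _)).mul_left ih

theorem conj_word {v : V} (h : adj (D.c true) v) (i : ℕ) :
    (D.word i)⁻¹ * PresentedGroup.of v * D.word i = PresentedGroup.of v := by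
  rw [mul_assoc, ← (D.commute_word h i).eq, inv_mul_cancel_left]

theorem commute_conj (g : RACG adj) {u v : V} (h : adj u v) :
    Commute (g⁻¹ * PresentedGroup.of u * g) (g⁻¹ * PresentedGroup.of v * g) := by
  have := (commute_of h).map (MulAut.conj g⁻¹)
  simpa [MulAut.conj_apply] using this

/-- The inclusion of the unfolded group as a reflection subgroup. -/
noncomputable def incl : RACG adj' →* RACG adj :=
  lift (fun v => (D.word (D.idx v))⁻¹ * PresentedGroup.of (D.proj v) * D.word (D.idx v))
    (fun v => by
      have := of_mul_self (adj := adj) (D.proj v)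
      simp only [mul_assoc, mul_inv_cancel_left]
      rw [← mul_assoc (PresentedGroup.of _) (PresentedGroup.of _), this, one_mul, inv_mul_cancel])
    (fun u v huv => by
      obtain ⟨h, h' | h' | h'⟩ := D.adj_proj u v huv
      · simp only [h']
        exact commute_conj _ h
      · rw [D.conj_word h' (D.idx u), ← D.conj_word h' (D.idx v)]
        exact commute_conj _ h
      · rw [D.conj_word h' (D.idx v), ← D.conj_word h' (D.idx u)]
        exact commute_conj _ h)

theorem incl_of (v : V') : D.incl (PresentedGroup.of v) =
    (D.word (D.idx v))⁻¹ * PresentedGroup.of (D.proj v) * D.word (D.idx v) :=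
  lift_of _ _ _ v

theorem of_mul_word {v : V} (hv : v ∉ Set.range D.c) {i : ℕ} (hi : i < m) :
    PresentedGroup.of v * D.word i =
      D.word i * D.incl (PresentedGroup.of (D.copy i v)) := by
  rw [incl_of, D.proj_copy i v hv]
  rcases D.idx_copy i v hv hi with h | h
  · rw [h]; group
  · rw [D.conj_word h, (D.commute_word h i).eq]

theorem exists_eq_word_mul (w : RACG adj) :
    ∃ i < m, ∃ y, w = D.word i * D.incl y := by
  induction w using induction_left with
  | one => exact ⟨0, D.pos, 1, by simp [word]⟩
  | mul v w ih =>
    obtain ⟨i, hi, y, rfl⟩ := ih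
    rw [← mul_assoc]
    by_cases hv : v ∈ Set.range D.c
    · obtain ⟨t, rfl⟩ := hv
      by_cases ht : t = i.bodd
      · subst ht
        by_cases him : i + 1 < m
        · exact ⟨i + 1, him, y, rfl⟩
        · obtain rfl : i = m - 1 := by omega
          refine ⟨m - 1, hi, PresentedGroup.of D.e₁ * y, ?_⟩
          rw [map_mul, incl_of, D.idx_e₁, D.proj_e₁]
          group
      · cases i with
        | zero =>
          obtain rfl : t = true := by simpa using ht
          refine ⟨0, hi, PresentedGroup.of D.e₀ * y, ?_⟩
          rw [map_mul, incl_of, D.idx_e₀, D.proj_e₀]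
          group
        | succ j =>
          obtain rfl : t = j.bodd := by
            rw [Nat.bodd_succ] at ht
            simpa using ht
          refine ⟨j, by omega, y, ?_⟩
          rw [word, ← mul_assoc, of_mul_self, one_mul]
    · refine ⟨i, hi, PresentedGroup.of (D.copy i v) * y, ?_⟩
      rw [D.of_mul_word hv hi, map_mul, mul_assoc]

theorem finiteIndex_range_incl : D.incl.range.FiniteIndex := by
  have : Finite (RACG adj ⧸ D.incl.range) := by
    refine Finite.of_surjective (fun i : Fin m => (D.word i : RACG adj ⧸ D.incl.range)) ?_
    intro q
    obtain ⟨w, rfl⟩ := QuotientGroup.mk_surjective q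
    obtain ⟨i, hi, y, rfl⟩ := D.exists_eq_word_mul w
    exact ⟨⟨i, hi⟩, QuotientGroup.eq.mpr ⟨y, by simp⟩⟩
  exact Subgroup.finiteIndex_of_finite_quotient

/-- The action of a dihedral generator on `m` consecutive chambers, each labelled by an element of
the unfolded group. -/
noncomputable def reflect (t : Bool) (p : ℕ × RACG adj') : ℕ × RACG adj' :=
  if m ≤ p.1 then p
  else if p.1.bodd = t then
    if p.1 + 1 < m then (p.1 + 1, p.2) else (p.1, PresentedGroup.of D.e₁ * p.2)
  else if p.1 = 0 then (0, PresentedGroup.of D.e₀ * p.2) else (p.1 - 1, p.2)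

theorem reflect_involutive (t : Bool) : Function.Involutive (D.reflect t) := by
  rintro ⟨i, x⟩
  have e0 := of_mul_self (adj := adj') D.e₀
  have e1 := of_mul_self (adj := adj') D.e₁
  by_cases hm : m ≤ i
  · simp [reflect, hm]
  by_cases hb : i.bodd = t
  · by_cases hi : i + 1 < m
    · have : ¬ m ≤ i + 1 := by omega
      subst hb
      simp [reflect, hm, hi, this]
    · simp [reflect, hm, hi, hb, ← mul_assoc, e1]
  · cases i with
    | zero => simp_all [reflect, ← mul_assoc]
    | succ j =>
      have h1 : ¬ m ≤ j := by omega
      have h2 : j.bodd = t := by simpa using hb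
      have h3 : j + 1 < m := by omega
      subst h2
      simp [reflect, hm, h1, h3]

/-- The action of a generator on labelled chambers. -/
noncomputable def act (v : V) (p : ℕ × RACG adj') : ℕ × RACG adj' :=
  if v = D.c false then D.reflect false p
  else if v = D.c true then D.reflect true p
  else (p.1, PresentedGroup.of (D.copy p.1 v) * p.2)

theorem act_c (t : Bool) : D.act (D.c t) = D.reflect t := by
  funext p
  cases t <;> simp [act, D.c_injective.eq_iff]

theorem act_of_notMem {v : V} (hv : v ∉ Set.range D.c) (p : ℕ × RACG adj') :
    D.act v p = (p.1, PresentedGroup.of (D.copy p.1 v) * p.2) := by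
  have h (t) : v ≠ D.c t := fun h => hv ⟨t, h.symm⟩
  simp [act, h]

theorem act_involutive (v : V) : Function.Involutive (D.act v) := by
  by_cases hv : v ∈ Set.range D.c
  · obtain ⟨t, rfl⟩ := hv
    rw [act_c]
    exact D.reflect_involutive t
  · intro p
    simp [act_of_notMem D hv, ← mul_assoc, of_mul_self]

theorem act_c_comm {t : Bool} {v : V} (h : adj (D.c t) v) (p : ℕ × RACG adj') :
    D.act (D.c t) (D.act v p) = D.act v (D.act (D.c t) p) := by
  have e0 := commute_of (D.adj_e₀ t v h 0)
  have e1 := commute_of (D.adj_e₁ t v h 0)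
  have hc (i) : D.copy i v = D.copy 0 v := D.copy_eq t v h i 0
  simp only [act_c, act_of_notMem D (D.notMem_of_adj t v h), hc]
  unfold reflect
  split_ifs <;> simp [← mul_assoc, e0.eq, e1.eq]

theorem act_comm {u v : V} (h : adj u v) (p : ℕ × RACG adj') :
    D.act u (D.act v p) = D.act v (D.act u p) := by
  by_cases hu : u ∈ Set.range D.c
  · obtain ⟨t, rfl⟩ := hu
    exact D.act_c_comm h p
  by_cases hv : v ∈ Set.range D.c
  · obtain ⟨t, rfl⟩ := hv
    exact (D.act_c_comm (D.adj_symm _ _ h) p).symm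
  simp [act_of_notMem D hu, act_of_notMem D hv, ← mul_assoc,
    (commute_of (D.adj_copy p.1 u v h hu hv)).eq]

/-- The action of the group on labelled chambers. -/
noncomputable def action : RACG adj →* Equiv.Perm (ℕ × RACG adj') :=
  lift (fun v => (D.act_involutive v).toPerm)
    (fun v => Equiv.ext fun p => D.act_involutive v p)
    (fun _ _ h => Equiv.ext fun p => D.act_comm h p)

theorem action_of (v : V) (p : ℕ × RACG adj') :
    D.action (PresentedGroup.of v) p = D.act v p :=
  congrArg (fun σ : Equiv.Perm _ => σ p) (lift_of _ _ _ v)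

theorem action_word {i : ℕ} (hi : i < m) (x : RACG adj') :
    D.action (D.word i) (0, x) = (i, x) := by
  induction i with
  | zero => simp [word]
  | succ i ih =>
    have : ¬ m ≤ i := by omega
    rw [word, map_mul, Equiv.Perm.mul_apply, ih (by omega), action_of, act_c]
    simp [reflect, hi, this]

theorem act_proj (v : V') (x : RACG adj') :
    D.act (D.proj v) (D.idx v, x) = (D.idx v, PresentedGroup.of v * x) := by
  have hm := D.pos
  by_cases h0 : v = D.e₀
  · subst h0
    rw [D.proj_e₀, D.idx_e₀, act_c]
    simp [reflect, hm.ne']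
  by_cases h1 : v = D.e₁
  · subst h1
    rw [D.proj_e₁, D.idx_e₁, act_c]
    have h2 : ¬ m ≤ m - 1 := by omega
    have h3 : ¬ m - 1 + 1 < m := by omega
    simp only [reflect, h2, h3, if_true, if_false]
  · rw [act_of_notMem D (D.proj_notMem v h0 h1), D.copy_idx_proj v h0 h1]

theorem action_incl (y x : RACG adj') : D.action (D.incl y) (0, x) = (0, y * x) := by
  induction y using induction_left generalizing x with
  | one => simp
  | mul v y ih =>
    rw [map_mul, map_mul, Equiv.Perm.mul_apply, ih, incl_of, map_mul, map_mul,
      Equiv.Perm.mul_apply, Equiv.Perm.mul_apply, D.action_word (D.idx_lt v), action_of, act_proj,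
      map_inv, Equiv.Perm.inv_eq_iff_eq, D.action_word (D.idx_lt v), mul_assoc]

theorem incl_injective : Function.Injective D.incl := by
  intro y z h
  have h2 := D.action_incl y 1
  rw [h, action_incl] at h2
  simpa using h2.symm

theorem abstractlyCommensurable (D : DihedralUnfolding adj adj' m) :
    AbstractlyCommensurable (RACG adj) (RACG adj') :=
  ⟨D.incl.range, ⊤, D.finiteIndex_range_incl, inferInstance,
    ⟨(D.incl.ofInjective D.incl_injective).symm.trans Subgroup.topEquiv.symm⟩⟩

end DihedralUnfolding

end RACG

namespace ThetaVertex

variable {k k' : ℕ} {n : Fin k → ℕ} {n' : Fin k' → ℕ}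

theorem inr_eq_inr_iff {p q : Fin k} {i : Fin (n p)} {j : Fin (n q)} :
    (Sum.inr ⟨p, i⟩ : ThetaVertex n) = Sum.inr ⟨q, j⟩ ↔ p = q ∧ (i : ℕ) = j := by
  constructor
  · intro h
    cases h
    exact ⟨rfl, rfl⟩
  · rintro ⟨rfl, h⟩
    rw [Fin.ext h]

/-- The map of Θ-graphs induced by a map of paths that preserves lengths. -/
def map (g : Fin k → Fin k') (hg : ∀ p, n' (g p) = n p) : ThetaVertex n → ThetaVertex n'
  | Sum.inl b => Sum.inl b
  | Sum.inr ⟨p, i⟩ => Sum.inr ⟨g p, i.cast (hg p).symm⟩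

theorem adj_map (g : Fin k → Fin k') (hg : ∀ p, n' (g p) = n p) {u v : ThetaVertex n}
    (h : ThetaAdj n u v) : ThetaAdj n' (map g hg u) (map g hg v) := by
  rcases u with b | ⟨p, i⟩ <;> rcases v with b' | ⟨q, j⟩ <;> simp only [ThetaAdj, map] at h ⊢
  · simpa [hg] using h
  · simpa [hg] using h
  · obtain ⟨h1, h2⟩ := h
    obtain rfl := Fin.ext h1
    exact ⟨rfl, h2⟩

/-- The interior vertex of a path with a single interior vertex. -/
def middle (p : Fin k) (hp : n p = 1) : ThetaVertex n :=
  Sum.inr ⟨p, ⟨0, by omega⟩⟩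

theorem inr_eq_middle_iff {p q : Fin k} {i : Fin (n p)} (hq : n q = 1) :
    (Sum.inr ⟨p, i⟩ : ThetaVertex n) = middle q hq ↔ p = q := by
  rw [middle, inr_eq_inr_iff]
  refine ⟨And.left, ?_⟩
  rintro rfl
  have := i.isLt
  exact ⟨rfl, by simp only; omega⟩

theorem adj_symm (u v : ThetaVertex n) (h : ThetaAdj n u v) : ThetaAdj n v u := by
  rcases u with b | ⟨p, i⟩ <;> rcases v with b' | ⟨q, j⟩ <;> simp only [ThetaAdj] at h ⊢
  · exact h
  · exact h
  · exact ⟨h.1.symm, h.2.symm⟩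

theorem adj_middle_iff {p : Fin k} (hp : n p = 1) (v : ThetaVertex n) :
    ThetaAdj n (middle p hp) v ↔ ∃ b, v = Sum.inl b := by
  rcases v with b | ⟨q, j⟩
  · cases b <;> simp [ThetaAdj, middle, hp]
  · simp only [ThetaAdj, middle, reduceCtorEq, exists_false, iff_false]
    rintro ⟨h1, h2⟩
    obtain rfl := Fin.ext h1
    have := j.isLt
    rw [or_false] at h2
    omega

end ThetaVertex

/-- The combinatorial data, on the level of paths, for unfolding a Θ-graph `m` times along two of
its paths `c false`, `c true` that have a single interior vertex. -/
structure ThetaUnfolding {k k' : ℕ} (n : Fin k → ℕ) (n' : Fin k' → ℕ) (m : ℕ) where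
  c : Bool → Fin k
  e₀ : Fin k'
  e₁ : Fin k'
  copy : ℕ → Fin k → Fin k'
  proj : Fin k' → Fin k
  idx : Fin k' → ℕ
  pos : 0 < m
  c_injective : Function.Injective c
  length_c : ∀ t, n (c t) = 1
  length_e₀ : n' e₀ = 1
  length_e₁ : n' e₁ = 1
  length_copy : ∀ i p, n' (copy i p) = n p
  length_proj : ∀ p, n (proj p) = n' p
  proj_e₀ : proj e₀ = c true
  proj_e₁ : proj e₁ = c (m - 1).bodd
  idx_e₀ : idx e₀ = 0
  idx_e₁ : idx e₁ = m - 1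
  proj_ne : ∀ p, p ≠ e₀ → p ≠ e₁ → ∀ t, proj p ≠ c t
  idx_lt : ∀ p, idx p < m
  copy_idx_proj : ∀ p, p ≠ e₀ → p ≠ e₁ → copy (idx p) (proj p) = p
  proj_copy : ∀ i p, (∀ t, p ≠ c t) → proj (copy i p) = p
  idx_copy : ∀ i p, (∀ t, p ≠ c t) → i < m → idx (copy i p) = i

namespace ThetaUnfolding

open ThetaVertex

variable {k k' : ℕ} {n : Fin k → ℕ} {n' : Fin k' → ℕ} {m : ℕ}

/-- The chamber index of a vertex of the unfolded Θ-graph; essential vertices lie in all chambers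
and get index `0`. -/
def vertexIdx (D : ThetaUnfolding n n' m) : ThetaVertex n' → ℕ
  | Sum.inl _ => 0
  | Sum.inr ⟨p, _⟩ => D.idx p

/-- The unfolding of the Θ-graph determined by an unfolding of its paths. -/
def toDihedralUnfolding (D : ThetaUnfolding n n' m) :
    RACG.DihedralUnfolding (ThetaAdj n) (ThetaAdj n') m where
  c t := middle (D.c t) (D.length_c t)
  e₀ := middle D.e₀ D.length_e₀
  e₁ := middle D.e₁ D.length_e₁
  copy i := map (D.copy i) (D.length_copy i)
  proj := map D.proj D.length_proj
  idx := D.vertexIdx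
  pos := D.pos
  c_injective s t h := D.c_injective ((inr_eq_middle_iff _).mp h)
  adj_symm := adj_symm
  adj_copy i u v h _ _ := adj_map _ _ h
  notMem_of_adj t v h := by
    obtain ⟨b, rfl⟩ := (adj_middle_iff _ _).mp h
    simp [middle]
  adj_of_adj t v h s := (adj_middle_iff _ _).mpr ((adj_middle_iff _ _).mp h)
  copy_eq t v h i j := by
    obtain ⟨b, rfl⟩ := (adj_middle_iff _ _).mp h
    rfl
  adj_e₀ t v h i := by
    obtain ⟨b, rfl⟩ := (adj_middle_iff _ _).mp h
    exact (adj_middle_iff _ _).mpr ⟨b, rfl⟩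
  adj_e₁ t v h i := by
    obtain ⟨b, rfl⟩ := (adj_middle_iff _ _).mp h
    exact (adj_middle_iff _ _).mpr ⟨b, rfl⟩
  adj_proj u v h := by
    refine ⟨adj_map _ _ h, ?_⟩
    rcases u with b | ⟨p, i⟩
    · exact Or.inr (Or.inl ((adj_middle_iff _ _).mpr ⟨b, rfl⟩))
    rcases v with b | ⟨q, j⟩
    · exact Or.inr (Or.inr ((adj_middle_iff _ _).mpr ⟨b, rfl⟩))
    · obtain rfl := Fin.ext h.1
      exact Or.inl rfl
  proj_e₀ := (inr_eq_middle_iff _).mpr D.proj_e₀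
  proj_e₁ := (inr_eq_middle_iff _).mpr D.proj_e₁
  idx_e₀ := D.idx_e₀
  idx_e₁ := D.idx_e₁
  proj_notMem v h0 h1 := by
    rintro ⟨t, ht⟩
    rcases v with b | ⟨p, i⟩
    · simp [map, middle] at ht
    · rw [ne_eq, inr_eq_middle_iff] at h0 h1
      exact D.proj_ne p h0 h1 t ((inr_eq_middle_iff _).mp ht.symm)
  idx_lt v := by
    rcases v with b | ⟨p, i⟩
    · exact D.pos
    · exact D.idx_lt p
  copy_idx_proj v h0 h1 := by
    rcases v with b | ⟨p, i⟩
    · rfl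
    · rw [ne_eq, inr_eq_middle_iff] at h0 h1
      exact inr_eq_inr_iff.mpr ⟨D.copy_idx_proj p h0 h1, rfl⟩
  proj_copy i v hv := by
    rcases v with b | ⟨p, j⟩
    · rfl
    · refine inr_eq_inr_iff.mpr ⟨D.proj_copy i p fun t ht => hv ⟨t, ?_⟩, rfl⟩
      exact ((inr_eq_middle_iff _).mpr ht).symm
  idx_copy i v hv hi := by
    rcases v with b | ⟨p, j⟩
    · exact Or.inr ((adj_middle_iff _ _).mpr ⟨b, rfl⟩)
    · refine Or.inl (D.idx_copy i p (fun t ht => hv ⟨t, ?_⟩) hi)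
      exact ((inr_eq_middle_iff _).mpr ht).symm

end ThetaUnfolding

/-- **Lemma 4.8.** Let `Θ` be the generalized Θ-graph with `ℓ ≥ 2` paths of parameter `1`
and `h` paths of parameters `N 0, …, N (h-1) ≥ 2`. Then for every `m ≥ 1`, the group
`W_Θ` is abstractly commensurable to `W_{Θ'}`, where `Θ'` has `m(ℓ−2)+2` paths of
parameter `1` and exactly `m` paths of parameter `N j` for each `j`. -/
theorem thetaRACG_commensurable_hyperbolicDegree
    (ℓ h : ℕ) (hℓ : 2 ≤ ℓ) (hk : 3 ≤ ℓ + h) (N : Fin h → ℕ) (hN : ∀ j, 2 ≤ N j)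
    (m : ℕ) (hm : 1 ≤ m) :
    AbstractlyCommensurable
      (ThetaRACG (fun i : Fin (ℓ + h) =>
        if hi : (i : ℕ) < ℓ then 1 else N ⟨(i : ℕ) - ℓ, by have := i.isLt; omega⟩))
      (ThetaRACG (fun i : Fin (m * (ℓ - 2) + 2 + m * h) =>
        if hi : (i : ℕ) < m * (ℓ - 2) + 2 then 1
        else N ⟨((i : ℕ) - (m * (ℓ - 2) + 2)) % h, by
          have hb := i.isLt
          have h2 : 0 < m * h := by omega
          have h3 : 0 < h := by
            rcases Nat.eq_zero_or_pos h with h0 | h0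
            · subst h0; simp at h2
            · exact h0
          exact Nat.mod_lt _ h3⟩)) := by
  have hdiv (a b i r : ℕ) (hr : r < b) (ha : a = i * b + r) : a / b = i ∧ a % b = r := by
    subst ha
    exact ⟨by rw [mul_comm, Nat.mul_add_div (by omega), Nat.div_eq_of_lt hr, add_zero],
      by rw [mul_comm, Nat.mul_add_mod, Nat.mod_eq_of_lt hr]⟩
  have hlt (i r b : ℕ) (hr : r < b) : (i % m) * b + r < m * b := by
    have h1 : i % m + 1 ≤ m := Nat.mod_lt i hm
    have h2 := Nat.mul_le_mul_right b h1
    rw [add_mul] at h2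
    omega
  have hsplit (a b : ℕ) (ha : a < m * b) : ∃ i < m, ∃ r < b, a = i * b + r := by
    have hb : 0 < b := Nat.pos_of_mul_pos_left (by omega : 0 < m * b)
    exact ⟨a / b, Nat.div_lt_of_lt_mul (by rwa [mul_comm]), a % b, Nat.mod_lt a hb,
      by rw [mul_comm, Nat.div_add_mod]⟩
  have hcases (p : ℕ) (hp : p < m * (ℓ - 2) + 2 + m * h) : p = 0 ∨ p = 1 ∨
      (∃ i < m, ∃ r < ℓ - 2, p = 2 + (i * (ℓ - 2) + r) ∧ i * (ℓ - 2) + r < m * (ℓ - 2)) ∨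
      ∃ i < m, ∃ r < h, p = m * (ℓ - 2) + 2 + (i * h + r) := by
    by_cases h0 : p = 0
    · exact Or.inl h0
    by_cases h1 : p = 1
    · exact Or.inr (Or.inl h1)
    by_cases h2 : p < m * (ℓ - 2) + 2
    · obtain ⟨i, hi, r, hr, e⟩ := hsplit (p - 2) (ℓ - 2) (by omega)
      exact Or.inr (Or.inr (Or.inl ⟨i, hi, r, hr, by omega, by omega⟩))
    · obtain ⟨i, hi, r, hr, e⟩ := hsplit (p - (m * (ℓ - 2) + 2)) h (by omega)
      exact Or.inr (Or.inr (Or.inr ⟨i, hi, r, hr, by omega⟩))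
  have hc (q : Fin (ℓ + h))
      (hq : ∀ t : Bool, q ≠ ⟨t.toNat, by have := t.toNat_lt; omega⟩) : ¬ (q : ℕ) < 2 := by
    have h0 := hq false
    have h1 := hq true
    rw [ne_eq, Fin.ext_iff] at h0 h1
    simp only [Bool.toNat_false, Bool.toNat_true] at h0 h1
    omega
  refine (ThetaUnfolding.toDihedralUnfolding (m := m) {
    c := fun t => ⟨t.toNat, by have := t.toNat_lt; omega⟩
    e₀ := ⟨0, by omega⟩
    e₁ := ⟨1, by omega⟩
    copy := fun i q =>
      if h2 : (q : ℕ) < 2 then ⟨0, by omega⟩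
      else if hq : (q : ℕ) < ℓ then ⟨2 + ((i % m) * (ℓ - 2) + (q - 2)), by
        have := hlt i (q - 2) (ℓ - 2) (by omega)
        omega⟩
      else ⟨m * (ℓ - 2) + 2 + ((i % m) * h + (q - ℓ)), by
        have := hlt i (q - ℓ) h (by omega)
        omega⟩
    proj := fun p =>
      if h0 : (p : ℕ) = 0 then ⟨1, by omega⟩
      else if h1 : (p : ℕ) = 1 then ⟨(m - 1).bodd.toNat, by have := (m - 1).bodd.toNat_lt; omega⟩
      else if hp : (p : ℕ) < m * (ℓ - 2) + 2 then ⟨2 + (p - 2) % (ℓ - 2), by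
        have : 0 < ℓ - 2 := Nat.pos_of_mul_pos_left (a := m) (by omega)
        have := Nat.mod_lt (p - 2) this
        omega⟩
      else ⟨ℓ + (p - (m * (ℓ - 2) + 2)) % h, by
        have : 0 < h := Nat.pos_of_mul_pos_left (a := m) (by omega)
        have := Nat.mod_lt (p - (m * (ℓ - 2) + 2)) this
        omega⟩
    idx := fun p =>
      if (p : ℕ) = 0 then 0
      else if (p : ℕ) = 1 then m - 1
      else if (p : ℕ) < m * (ℓ - 2) + 2 then (p - 2) / (ℓ - 2)
      else (p - (m * (ℓ - 2) + 2)) / h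
    pos := hm
    c_injective := ?_
    length_c := ?_
    length_e₀ := ?_
    length_e₁ := ?_
    length_copy := ?_
    length_proj := ?_
    proj_e₀ := ?_
    proj_e₁ := ?_
    idx_e₀ := ?_
    idx_e₁ := ?_
    proj_ne := ?_
    idx_lt := ?_
    copy_idx_proj := ?_
    proj_copy := ?_
    idx_copy := ?_ }).abstractlyCommensurable
  · intro s t hst
    revert hst
    cases s <;> cases t <;> simp
  · intro t
    have := t.toNat_lt
    exact dif_pos (by simp only; omega)
  · exact dif_pos (by simp)
  · exact dif_pos (by simp)
  · intro i q
    by_cases h2 : (q : ℕ) < 2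
    · have : (q : ℕ) < ℓ := by omega
      simp [h2, this]
    by_cases hq : (q : ℕ) < ℓ
    · have := hlt i (q - 2) (ℓ - 2) (by omega)
      have : 2 + (i % m * (ℓ - 2) + (q - 2)) < m * (ℓ - 2) + 2 := by omega
      simp [h2, hq, this]
    · have := (hdiv _ h (i % m) (q - ℓ) (by omega) rfl).2
      simp [h2, hq, this]
  · intro p
    obtain hp | hp | ⟨i, hi, r, hr, hp, hlt'⟩ | ⟨i, hi, r, hr, hp⟩ := hcases p p.isLt
    · have : 1 < ℓ := by omega
      simp [hp, this]
    · have : (m - 1).bodd.toNat < ℓ := by have := (m - 1).bodd.toNat_lt; omega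
      simp [hp, this]
    · have e := hdiv _ (ℓ - 2) i r hr rfl
      have h3 : (p : ℕ) < m * (ℓ - 2) + 2 := by omega
      have h4 : 2 + r < ℓ := by omega
      have h5 : (p : ℕ) - 2 = i * (ℓ - 2) + r := by omega
      have h6 : (p : ℕ) ≠ 0 ∧ (p : ℕ) ≠ 1 := by omega
      simp only [h6.1, h6.2, h3, h4, h5, e.2, dif_pos, dif_neg, not_false_eq_true]
    · have e := hdiv _ h i r hr rfl
      have h3 : ¬ (p : ℕ) < m * (ℓ - 2) + 2 := by omega
      have h5 : (p : ℕ) - (m * (ℓ - 2) + 2) = i * h + r := by omega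
      have h6 : (p : ℕ) ≠ 0 ∧ (p : ℕ) ≠ 1 := by omega
      simp [h6, h3, h5, e]
  · simp
  · simp
  · simp
  · simp
  · intro p h0 h1 t
    rw [ne_eq, Fin.ext_iff] at h0 h1
    have := t.toNat_lt
    simp only at h0 h1
    simp only [h0, h1, dite_false, ne_eq]
    split_ifs <;> simp only [Fin.ext_iff] <;> omega
  · intro p
    obtain hp | hp | ⟨i, hi, r, hr, hp, hlt'⟩ | ⟨i, hi, r, hr, hp⟩ := hcases p p.isLt
    · simp [hp]; omega
    · simp [hp]; omega
    · have e := hdiv _ (ℓ - 2) i r hr rfl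
      have h3 : (p : ℕ) < m * (ℓ - 2) + 2 := by omega
      have h5 : (p : ℕ) - 2 = i * (ℓ - 2) + r := by omega
      have h6 : (p : ℕ) ≠ 0 ∧ (p : ℕ) ≠ 1 := by omega
      simpa [h6, h3, h5, e] using hi
    · have e := hdiv _ h i r hr rfl
      have h3 : ¬ (p : ℕ) < m * (ℓ - 2) + 2 := by omega
      have h5 : (p : ℕ) - (m * (ℓ - 2) + 2) = i * h + r := by omega
      have h6 : (p : ℕ) ≠ 0 ∧ (p : ℕ) ≠ 1 := by omega
      simpa [h6, h3, h5, e] using hi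
  · intro p h0 h1
    rw [ne_eq, Fin.ext_iff] at h0 h1
    obtain hp | hp | ⟨i, hi, r, hr, hp, hlt'⟩ | ⟨i, hi, r, hr, hp⟩ := hcases p p.isLt
    · exact absurd hp h0
    · exact absurd hp h1
    · have e := hdiv _ (ℓ - 2) i r hr rfl
      have h3 : (p : ℕ) < m * (ℓ - 2) + 2 := by omega
      have h4 : 2 + r < ℓ ∧ ¬ 2 + r ≤ 1 := by omega
      have h5 : (p : ℕ) - 2 = i * (ℓ - 2) + r := by omega
      have h6 : (p : ℕ) ≠ 0 ∧ (p : ℕ) ≠ 1 := by omega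
      simp [h6, h3, h4, h5, e, Fin.ext_iff, Nat.mod_eq_of_lt hi]
      omega
    · have e := hdiv _ h i r hr rfl
      have h3 : ¬ (p : ℕ) < m * (ℓ - 2) + 2 := by omega
      have h4 : ¬ ℓ + r < 2 := by omega
      have h5 : (p : ℕ) - (m * (ℓ - 2) + 2) = i * h + r := by omega
      have h6 : (p : ℕ) ≠ 0 ∧ (p : ℕ) ≠ 1 := by omega
      simp [h6, h3, h4, h5, e, Fin.ext_iff, Nat.mod_eq_of_lt hi]
      omega
  · intro i q hq
    have h2 : ¬ (q : ℕ) < 2 := hc q hq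
    by_cases hq' : (q : ℕ) < ℓ
    · have := hlt i (q - 2) (ℓ - 2) (by omega)
      have h3 : 2 + (i % m * (ℓ - 2) + (q - 2)) < m * (ℓ - 2) + 2 := by omega
      have h4 : 2 + (i % m * (ℓ - 2) + (q - 2)) ≠ 1 := by omega
      have e := hdiv _ (ℓ - 2) (i % m) (q - 2) (by omega) rfl
      simp [h2, hq', h3, h4, e, Fin.ext_iff]
      omega
    · have e := hdiv _ h (i % m) (q - ℓ) (by omega) rfl
      have h4 : m * (ℓ - 2) + 2 + (i % m * h + (q - ℓ)) ≠ 1 := by omega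
      simp [h2, hq', h4, e, Fin.ext_iff]
      omega
  · intro i q hq hi
    have h2 : ¬ (q : ℕ) < 2 := hc q hq
    have him := Nat.mod_eq_of_lt hi
    by_cases hq' : (q : ℕ) < ℓ
    · have := hlt i (q - 2) (ℓ - 2) (by omega)
      have h3 : 2 + (i % m * (ℓ - 2) + (q - 2)) < m * (ℓ - 2) + 2 := by omega
      have h4 : 2 + (i % m * (ℓ - 2) + (q - 2)) ≠ 1 := by omega
      have e := hdiv _ (ℓ - 2) (i % m) (q - 2) (by omega) rfl
      rw [him] at h3 h4 e
      simp [him, h2, hq', h3, h4, e]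
    · have e := hdiv _ h (i % m) (q - ℓ) (by omega) rfl
      have h4 : m * (ℓ - 2) + 2 + (i % m * h + (q - ℓ)) ≠ 1 := by omega
      rw [him] at h4 e
      simp [him, h2, hq', h4, e]
end
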